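/- cof(σC₀, M) = cof(M), where σC₀ is the σ-ideal generated by minimal Cantor sets in the Hilbert cube I^ω and M is the σ-ideal of meager subsets of I^ω. -/

import Mathlib

open Set Topology Cardinal

/-- The Hilbert cube `[0,1]^ℕ` with the product topology. -/
abbrev HilbertCube : Type := ℕ → ↥(Set.Icc (0:ℝ) 1)

/-- An ideal of subsets: a nonempty family closed under subsets and finite unions. -/
def IsIdeal {X : Type*} (I : Set (Set X)) : Prop :=
  I.Nonempty ∧ (∀ A ∈ I, ∀ B, B ⊆ A → B ∈ I) ∧ (∀ A ∈ I, ∀ B ∈ I, A ∪ B ∈ I)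

/-- A σ-ideal: an ideal closed under countable unions. -/
def IsSigmaIdeal {X : Type*} (I : Set (Set X)) : Prop :=
  IsIdeal I ∧ ∀ A : ℕ → Set X, (∀ n, A n ∈ I) → (⋃ n, A n) ∈ I

/-- A non-trivial ideal contains an uncountable set but not the whole space. -/
def NontrivialIdeal {X : Type*} (I : Set (Set X)) : Prop :=
  (∃ A ∈ I, ¬ A.Countable) ∧ Set.univ ∉ I

/-- An ideal on a topological space is topologically invariant if it is preserved by
all homeomorphisms of the space. -/
def TopInvariant {X : Type*} [TopologicalSpace X] (I : Set (Set X)) : Prop :=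
  ∀ h : X ≃ₜ X, {B | ∃ A ∈ I, B = h '' A} = I

/-- `I` has a base all of whose members satisfy `P`. -/
def HasBaseWith {X : Type*} (I : Set (Set X)) (P : Set X → Prop) : Prop :=
  ∃ B ⊆ I, (∀ A ∈ I, ∃ C ∈ B, A ⊆ C) ∧ ∀ C ∈ B, P C

/-- A set has the Baire property if it differs from some open set by a meager set. -/
def HasBaireProperty {X : Type*} [TopologicalSpace X] (A : Set X) : Prop :=
  ∃ U : Set X, IsOpen U ∧ IsMeagre ((A \ U) ∪ (U \ A))

/-- The σ-ideal of meager subsets of a topological space. -/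
def MeagerIdeal (X : Type*) [TopologicalSpace X] : Set (Set X) := {A | IsMeagre A}

/-- The σ-ideal generated by a family `F`: all subsets of countable unions of members
of `F`. -/
def sigmaGenerated {X : Type*} (F : Set (Set X)) : Set (Set X) :=
  {A | ∃ S : ℕ → Set X, (∀ n, S n ∈ F) ∧ A ⊆ ⋃ n, S n}

/-- A Cantor set in the Hilbert cube: a subset homeomorphic to the Cantor cube. -/
def IsCantorSet (C : Set HilbertCube) : Prop := Nonempty (C ≃ₜ (ℕ → Bool))

/-- A minimal Cantor set: one that can be mapped into any other Cantor set by an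
ambient homeomorphism. -/
def IsMinimalCantorSet (A : Set HilbertCube) : Prop :=
  IsCantorSet A ∧ ∀ B : Set HilbertCube, IsCantorSet B →
    ∃ h : HilbertCube ≃ₜ HilbertCube, h '' A ⊆ B

/-- The family of all minimal Cantor sets in the Hilbert cube. -/
def CantorFamily : Set (Set HilbertCube) := {A | IsMinimalCantorSet A}

/-- The σ-ideal generated by minimal Cantor sets. -/
def sigmaC0 : Set (Set HilbertCube) := sigmaGenerated CantorFamily

/-- A minimal dense Gδ-subset of the Hilbert cube. -/
def IsMinimalDenseGdelta (A : Set HilbertCube) : Prop :=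
  IsGδ A ∧ Dense A ∧ ∀ B : Set HilbertCube, IsGδ B → Dense B →
    ∃ h : HilbertCube ≃ₜ HilbertCube, h '' A ⊆ B

/-- The family of all minimal dense Gδ-sets in the Hilbert cube. -/
def GdeltaFamily : Set (Set HilbertCube) := {A | IsMinimalDenseGdelta A}

/-- The σ-ideal generated by minimal dense Gδ-sets. -/
def sigmaG0 : Set (Set HilbertCube) := sigmaGenerated GdeltaFamily

/-- `cov(I)`: the least cardinality of a subfamily of `I` covering the space. -/
noncomputable def covIdeal {X : Type*} (I : Set (Set X)) : Cardinal :=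
  sInf {c | ∃ A : Set (Set X), A ⊆ I ∧ ⋃₀ A = Set.univ ∧ c = #A}

/-- `non(I)`: the least cardinality of a subset of the space not in `I`. -/
noncomputable def nonIdeal {X : Type*} (I : Set (Set X)) : Cardinal :=
  sInf {c | ∃ A : Set X, A ∉ I ∧ c = #A}

/-- `add(I,J)`: the least cardinality of a subfamily of `I` whose union is not in `J`. -/
noncomputable def addIdeal2 {X : Type*} (I J : Set (Set X)) : Cardinal :=
  sInf {c | ∃ A : Set (Set X), A ⊆ I ∧ ⋃₀ A ∉ J ∧ c = #A}

/-- `add(I) = add(I,I)`. -/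
noncomputable def addIdeal {X : Type*} (I : Set (Set X)) : Cardinal := addIdeal2 I I

/-- `cof(I,J)`: the least cardinality of a subfamily of `J` cofinal in `I`. -/
noncomputable def cofIdeal2 {X : Type*} (I J : Set (Set X)) : Cardinal :=
  sInf {c | ∃ A : Set (Set X), A ⊆ J ∧ (∀ B ∈ I, ∃ C ∈ A, B ⊆ C) ∧ c = #A}

/-- `cof(I) = cof(I,I)`. -/
noncomputable def cofIdeal {X : Type*} (I : Set (Set X)) : Cardinal := cofIdeal2 I I

/-- The compact-open topology on the homeomorphism group of a space, induced by the
compact-open topology of the space of continuous self-maps. -/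
noncomputable instance homeoGroupTopology (X : Type*) [TopologicalSpace X] :
    TopologicalSpace (X ≃ₜ X) :=
  TopologicalSpace.induced (fun h : X ≃ₜ X => (⟨h, h.continuous⟩ : C(X, X)))
    ContinuousMap.compactOpen

/-- A Z-set: a closed set `A` such that for every open cover `U` of the space there is a
continuous map into the complement of `A` which is `U`-near to the identity. -/
def IsZSet {X : Type*} [TopologicalSpace X] (A : Set X) : Prop :=
  IsClosed A ∧ ∀ U : Set (Set X), (∀ V ∈ U, IsOpen V) → ⋃₀ U = Set.univ →
    ∃ f : C(X, X), (∀ x, f x ∉ A) ∧ ∀ x : X, ∃ V ∈ U, x ∈ V ∧ f x ∈ V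

/-- A σZ-set: a countable union of Z-sets. -/
def IsSigmaZSet {X : Type*} [TopologicalSpace X] (A : Set X) : Prop :=
  ∃ Z : ℕ → Set X, (∀ n, IsZSet (Z n)) ∧ A = ⋃ n, Z n

/-- The cube `[0,1]^n`. -/
abbrev FinCube (n : ℕ) : Type := Fin n → ↥(Set.Icc (0:ℝ) 1)

/-- A `Z_n`-set in the Hilbert cube: a closed set `A` such that maps avoiding `A` are
dense in the space `C([0,1]^n, I^ω)` with the compact-open topology. -/
def IsZnSet (n : ℕ) (A : Set HilbertCube) : Prop :=
  IsClosed A ∧ Dense {f : C(FinCube n, HilbertCube) | ∀ x, f x ∉ A}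

/-- A `Z_ω`-set in the Hilbert cube: a closed set which is a `Z_n`-set for all `n`. -/
def IsZomegaSet (A : Set HilbertCube) : Prop :=
  IsClosed A ∧ ∀ n : ℕ, IsZnSet n A

/-- Covering dimension of a space is at most `n`: every finite open cover has a finite
open refinement (still a cover) in which no point belongs to more than `n+1` members. -/
def CovDimLE (Y : Type*) [TopologicalSpace Y] (n : ℕ) : Prop :=
  ∀ U : Set (Set Y), U.Finite → (∀ V ∈ U, IsOpen V) → ⋃₀ U = Set.univ →
    ∃ V : Set (Set Y), V.Finite ∧ (∀ W ∈ V, IsOpen W) ∧ ⋃₀ V = Set.univ ∧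
      (∀ W ∈ V, ∃ W' ∈ U, W ⊆ W') ∧
      ∀ y : Y, {W ∈ V | y ∈ W}.ncard ≤ n + 1

/-- A `G_δ`-generated topologically invariant ideal on the Hilbert cube. -/
def GdeltaGenerated (I : Set (Set HilbertCube)) : Prop :=
  HasBaseWith I IsSigmaCompact ∧
  ∃ G : Set HilbertCube, IsGδ G ∧
    (∀ K : Set HilbertCube, K ⊆ G → IsCompact K → K ∈ I) ∧
    ∀ A ∈ I, IsCompact A →
      Dense {h : HilbertCube ≃ₜ HilbertCube | h '' A ⊆ G}

/-- A `G_δ*`-generated ideal: a preimage of a `G_δ`-generated ideal under an embedding. -/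
def GdeltaStarGenerated (I : Set (Set HilbertCube)) : Prop :=
  ∃ I' : Set (Set HilbertCube), GdeltaGenerated I' ∧
    ∃ e : HilbertCube → HilbertCube, IsEmbedding e ∧ I = {S | ∃ A ∈ I', S = e ⁻¹' A}

/-- A `σG_δ*`-generated ideal. -/
def SigmaGdeltaStarGenerated (I : Set (Set HilbertCube)) : Prop :=
  ∃ In : ℕ → Set (Set HilbertCube), (∀ n, GdeltaStarGenerated (In n)) ∧
    (∀ n, In n ⊆ I) ∧
    ∀ A ∈ I, ∃ K : ℕ → Set HilbertCube,
      (∀ n, IsCompact (K n) ∧ K n ∈ In n) ∧ A ⊆ ⋃ n, K n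

/-- The unit interval. -/
abbrev UI : Type := ↥(Set.Icc (0:ℝ) 1)

theorem exists_homeomorph_of_bijective {X Y : Type*} [TopologicalSpace X] [TopologicalSpace Y]
    [CompactSpace X] [T2Space Y] (f : X → Y) (hf : Continuous f) (hb : Function.Bijective f) :
    ∃ H : X ≃ₜ Y, ∀ x, H x = f x :=
  ⟨Continuous.homeoOfEquivCompactToT2 (f := Equiv.ofBijective f hb) hf, fun _ => rfl⟩

theorem exists_homeomorph_shear {Y Z : Type*} [TopologicalSpace Y] [TopologicalSpace Z]
    [CompactSpace Y] [CompactSpace Z] [T2Space Y] [T2Space Z] (Φ : Y → Z → Z)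
    (hc : Continuous fun p : Y × Z => Φ p.1 p.2) (hb : ∀ y, Function.Bijective (Φ y)) :
    ∃ H : (Y × Z) ≃ₜ (Y × Z), ∀ y z, H (y, z) = (y, Φ y z) := by
  obtain ⟨H, hH⟩ := exists_homeomorph_of_bijective (fun p : Y × Z => (p.1, Φ p.1 p.2))
    (by fun_prop) (by
      refine ⟨?_, ?_⟩
      · rintro ⟨a, b⟩ ⟨c, d⟩ h
        simp only [Prod.mk.injEq] at h
        obtain ⟨rfl, h⟩ := h
        rw [(hb a).1 h]
      · rintro ⟨a, b⟩
        obtain ⟨z, hz⟩ := (hb a).2 b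
        exact ⟨(a, z), by simp [hz]⟩)
  exact ⟨H, fun y z => hH (y, z)⟩

theorem mobius_denom_pos (a : ℝ) (t : UI) : 0 < 1 - (t : ℝ) + Real.exp a * t := by
  have := t.2.1
  have := t.2.2
  have := Real.exp_pos a
  rcases eq_or_lt_of_le t.2.2 with h | h
  · rw [h]; linarith
  · nlinarith

/-- The Möbius transformation of the unit interval translating the logit by `a`. -/
noncomputable def mobius (a : ℝ) (t : UI) : UI :=
  ⟨Real.exp a * t / (1 - t + Real.exp a * t), by
    have h := mobius_denom_pos a t
    have h1 := t.2.1
    have h2 := t.2.2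
    have h3 := Real.exp_pos a
    refine ⟨by positivity, ?_⟩
    rw [div_le_one h]; linarith⟩

theorem continuous_mobius : Continuous fun p : ℝ × UI => mobius p.1 p.2 := by
  unfold mobius
  refine Continuous.subtype_mk (Continuous.div (by fun_prop) (by fun_prop) ?_) _
  exact fun p => (mobius_denom_pos p.1 p.2).ne'

theorem mobius_neg_mobius (a : ℝ) (t : UI) : mobius (-a) (mobius a t) = t := by
  have h := mobius_denom_pos a t
  have h3 := Real.exp_pos a
  have h4 := mobius_denom_pos (-a) (mobius a t)
  apply Subtype.ext
  rw [mobius, div_eq_iff h4.ne']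
  simp only [mobius, Real.exp_neg]
  field_simp
  ring

theorem mobius_bijective (a : ℝ) : Function.Bijective (mobius a) :=
  ⟨Function.LeftInverse.injective (mobius_neg_mobius a),
    Function.RightInverse.surjective (g := mobius (-a)) fun t => by
      simpa using mobius_neg_mobius (-a) t⟩

/-- The log-odds function. -/
noncomputable def logit (s : ℝ) : ℝ := Real.log s - Real.log (1 - s)

theorem mobius_logit (s s' : UI) (h : (s : ℝ) ∈ Ioo (0:ℝ) 1) (h' : (s' : ℝ) ∈ Ioo (0:ℝ) 1) :
    mobius (logit s' - logit s) s = s' := by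
  have e : Real.exp (logit s' - logit s) = (s' : ℝ) * (1 - s) / (s * (1 - s')) := by
    have a1 : (0:ℝ) < s := h.1
    have a2 : (0:ℝ) < 1 - s := by linarith [h.2]
    have a3 : (0:ℝ) < s' := h'.1
    have a4 : (0:ℝ) < 1 - s' := by linarith [h'.2]
    rw [logit, logit, Real.exp_sub, Real.exp_sub, Real.exp_sub, Real.exp_log a1, Real.exp_log a2,
      Real.exp_log a3, Real.exp_log a4]
    field_simp
  have a1 : (0:ℝ) < s := h.1
  have a2 : (0:ℝ) < 1 - s := by linarith [h.2]
  have a3 : (0:ℝ) < s' := h'.1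
  have a4 : (0:ℝ) < 1 - s' := by linarith [h'.2]
  apply Subtype.ext
  rw [mobius]
  simp only
  rw [div_eq_iff (mobius_denom_pos _ _).ne', e]
  field_simp
  ring

theorem continuous_logit_comp {C : Type*} [TopologicalSpace C] (f : C → UI) (hf : Continuous f)
    (h : ∀ c, (f c : ℝ) ∈ Ioo (0:ℝ) 1) : Continuous fun c => logit (f c) := by
  unfold logit
  refine Continuous.sub (Continuous.log (by fun_prop) fun c => (h c).1.ne')
    (Continuous.log (by fun_prop) fun c => ?_)
  linarith [(h c).2]

/-- A piecewise linear homeomorphism of the square pushing the bottom edge into its interior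
and the left edge along itself, contracting in the first coordinate of its inverse. -/
noncomputable def pinchFun (p : UI × UI) : UI × UI :=
  let x : ℝ := p.1
  let y : ℝ := p.2
  let m := min y (2 * x)
  let u := x - y + m / 2
  let v := min ((1 - m / 2 + u) / 2) (2 * u + 1 - m)
  (Set.projIcc 0 1 zero_le_one (m / 2 + max v 0), Set.projIcc 0 1 zero_le_one (m + max (-v) 0))

/-- The inverse of `pinchFun`. -/
noncomputable def pinchInv (p : UI × UI) : UI × UI :=
  let w : ℝ := p.1
  let y : ℝ := p.2
  let m := min y (2 * w)
  let v := w - y + m / 2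
  let u := max (2 * v - (1 - m / 2)) ((v - (1 - m)) / 2)
  (Set.projIcc 0 1 zero_le_one (m / 2 + max u 0), Set.projIcc 0 1 zero_le_one (m + max (-u) 0))

theorem pinchFun_coe (p : UI × UI) :
    ((pinchFun p).1 : ℝ) = (min (p.2:ℝ) (2 * p.1)) / 2 +
      max (min ((1 - (min (p.2:ℝ) (2 * p.1)) / 2 +
      (p.1 - p.2 + (min (p.2:ℝ) (2 * p.1)) / 2)) / 2)
        (2 * (p.1 - p.2 + (min (p.2:ℝ) (2 * p.1)) / 2) + 1 - (min (p.2:ℝ) (2 * p.1)))) 0 ∧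
    ((pinchFun p).2 : ℝ) = (min (p.2:ℝ) (2 * p.1)) + max (-min ((1 - (min (p.2:ℝ) (2 * p.1)) / 2 +
      (p.1 - p.2 + (min (p.2:ℝ) (2 * p.1)) / 2)) / 2)
        (2 * (p.1 - p.2 + (min (p.2:ℝ) (2 * p.1)) / 2) + 1 - (min (p.2:ℝ) (2 * p.1)))) 0 := by
  obtain ⟨⟨x, hx0, hx1⟩, ⟨y, hy0, hy1⟩⟩ := p
  simp only [pinchFun]
  constructor <;> rw [Set.projIcc_of_mem] <;> simp only [mem_Icc] <;> grind

theorem pinchInv_coe (p : UI × UI) :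
    ((pinchInv p).1 : ℝ) = (min (p.2:ℝ) (2 * p.1)) / 2 + max (max
      (2 * (p.1 - p.2 + (min (p.2:ℝ) (2 * p.1)) / 2) - (1 - (min (p.2:ℝ) (2 * p.1)) / 2))
      (((p.1 - p.2 + (min (p.2:ℝ) (2 * p.1)) / 2) - (1 - (min (p.2:ℝ) (2 * p.1)))) / 2)) 0 ∧
    ((pinchInv p).2 : ℝ) = (min (p.2:ℝ) (2 * p.1)) + max (-max
      (2 * (p.1 - p.2 + (min (p.2:ℝ) (2 * p.1)) / 2) - (1 - (min (p.2:ℝ) (2 * p.1)) / 2))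
      (((p.1 - p.2 + (min (p.2:ℝ) (2 * p.1)) / 2) - (1 - (min (p.2:ℝ) (2 * p.1)))) / 2)) 0 := by
  obtain ⟨⟨x, hx0, hx1⟩, ⟨y, hy0, hy1⟩⟩ := p
  simp only [pinchInv]
  constructor <;> rw [Set.projIcc_of_mem] <;> simp only [mem_Icc] <;> grind

theorem pinchInv_pinchFun (p : UI × UI) : pinchInv (pinchFun p) = p := by
  have h1 := pinchFun_coe p
  have h2 := pinchInv_coe (pinchFun p)
  generalize pinchFun p = q at *
  generalize pinchInv q = r at *
  obtain ⟨⟨x, hx0, hx1⟩, ⟨y, hy0, hy1⟩⟩ := p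
  obtain ⟨⟨x', hx0', hx1'⟩, ⟨y', hy0', hy1'⟩⟩ := q
  obtain ⟨⟨x'', hx0'', hx1''⟩, ⟨y'', hy0'', hy1''⟩⟩ := r
  simp only at h1 h2
  obtain ⟨a, b⟩ := h1
  obtain ⟨c, d⟩ := h2
  refine Prod.ext (Subtype.ext ?_) (Subtype.ext ?_)
  · simp only
    grind
  · simp only
    grind

theorem pinchFun_pinchInv (p : UI × UI) : pinchFun (pinchInv p) = p := by
  have h1 := pinchInv_coe p
  have h2 := pinchFun_coe (pinchInv p)
  generalize pinchInv p = q at *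
  generalize pinchFun q = r at *
  obtain ⟨⟨x, hx0, hx1⟩, ⟨y, hy0, hy1⟩⟩ := p
  obtain ⟨⟨x', hx0', hx1'⟩, ⟨y', hy0', hy1'⟩⟩ := q
  obtain ⟨⟨x'', hx0'', hx1''⟩, ⟨y'', hy0'', hy1''⟩⟩ := r
  simp only at h1 h2
  obtain ⟨a, b⟩ := h1
  obtain ⟨c, d⟩ := h2
  refine Prod.ext (Subtype.ext ?_) (Subtype.ext ?_)
  · simp only
    grind
  · simp only
    grind

theorem continuous_pinchFun : Continuous pinchFun := by
  unfold pinchFun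
  refine Continuous.prodMk (continuous_projIcc.comp ?_) (continuous_projIcc.comp ?_) <;> fun_prop

theorem continuous_pinchInv : Continuous pinchInv := by
  unfold pinchInv
  refine Continuous.prodMk (continuous_projIcc.comp ?_) (continuous_projIcc.comp ?_) <;> fun_prop

/-- `pinchFun` as a homeomorphism of the square. -/
noncomputable def pinch : (UI × UI) ≃ₜ (UI × UI) where
  toFun := pinchFun
  invFun := pinchInv
  left_inv := pinchInv_pinchFun
  right_inv := pinchFun_pinchInv
  continuous_toFun := continuous_pinchFun
  continuous_invFun := continuous_pinchInv

/-- The midpoint of the unit interval. -/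
noncomputable def half : UI := ⟨1 / 2, by norm_num, by norm_num⟩

theorem half_coe : (half : ℝ) = 1 / 2 := rfl

theorem pinchFun_bottom (t : UI) :
    ((pinchFun (t, 0)).1 : ℝ) = (1 + t) / 2 ∧ (pinchFun (t, 0)).2 = 0 := by
  obtain ⟨h1, h2⟩ := pinchFun_coe (t, 0)
  generalize pinchFun (t, 0) = q at *
  obtain ⟨⟨x, hx0, hx1⟩, ⟨y, hy0, hy1⟩⟩ := q
  obtain ⟨t, ht0, ht1⟩ := t
  simp only [Set.Icc.coe_zero] at *
  refine ⟨?_, Subtype.ext ?_⟩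
  · grind
  · simp only [Set.Icc.coe_zero]
    grind

theorem pinchFun_zero : pinchFun (0, 0) = (half, 0) := by
  obtain ⟨h1, h2⟩ := pinchFun_bottom 0
  exact Prod.ext (Subtype.ext (by rw [h1]; simp [half])) h2

theorem pinchInv_lipschitz (w y y' : UI) :
    |((pinchInv (w, y)).1 : ℝ) - (pinchInv (w, y')).1| ≤ 3 / 4 * |(y : ℝ) - y'| := by
  wlog h : (y : ℝ) ≤ y' generalizing y y'
  · rw [abs_sub_comm, abs_sub_comm (y : ℝ)]
    exact this y' y (le_of_not_ge h)
  have h1 := (pinchInv_coe (w, y)).1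
  have h2 := (pinchInv_coe (w, y')).1
  rw [abs_of_nonpos (sub_nonpos.2 h)]
  generalize (pinchInv (w, y)).1 = a at *
  generalize (pinchInv (w, y')).1 = b at *
  obtain ⟨w, hw0, hw1⟩ := w
  obtain ⟨y, hy0, hy1⟩ := y
  obtain ⟨y', hy0', hy1'⟩ := y'
  obtain ⟨a, ha⟩ := a
  obtain ⟨b, hb⟩ := b
  simp only at *
  rw [abs_le]
  constructor <;> grind

theorem exists_homeomorph_bottom_interior :
    ∃ T : (UI × UI) ≃ₜ (UI × UI), ∀ t, ((T (t, 0)).1 : ℝ) ∈ Ioo (0:ℝ) 1 ∧ (T (t, 0)).2 = 0 := by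
  refine ⟨pinch.trans ((unitInterval.symmHomeomorph.prodCongr (Homeomorph.refl _)).trans pinch),
    fun t => ?_⟩
  obtain ⟨h1, h2⟩ := pinchFun_bottom t
  have e : pinch (t, 0) = ((pinchFun (t, 0)).1, 0) := Prod.ext rfl h2
  simp only [Homeomorph.trans_apply, e]
  obtain ⟨h3, h4⟩ := pinchFun_bottom (unitInterval.symm (pinchFun (t, 0)).1)
  refine ⟨?_, h4⟩
  change ((pinchFun (unitInterval.symm (pinchFun (t, 0)).1, 0)).1 : ℝ) ∈ _
  rw [h3, unitInterval.coe_symm_eq, h1]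
  have := t.2.1
  have := t.2.2
  constructor <;> linarith

/-- The sequence of states of the transducer defining `cascade`. -/
noncomputable def cascadeState (x : ℕ → UI) : ℕ → UI
  | 0 => x 0
  | n + 1 => (pinchFun (cascadeState x n, x (n + 1))).2

/-- The transducer built out of `pinchFun`. -/
noncomputable def cascade (x : ℕ → UI) (n : ℕ) : UI := (pinchFun (cascadeState x n, x (n + 1))).1

theorem continuous_cascadeState (n : ℕ) : Continuous fun x : ℕ → UI => cascadeState x n := by
  induction n with
  | zero => exact continuous_apply 0
  | succ n ih =>
    exact continuous_snd.comp (continuous_pinchFun.comp (ih.prodMk (continuous_apply _)))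

theorem continuous_cascade : Continuous cascade :=
  continuous_pi fun n => continuous_fst.comp
    (continuous_pinchFun.comp ((continuous_cascadeState n).prodMk (continuous_apply _)))

theorem pinchInv_cascade (x : ℕ → UI) (n : ℕ) :
    pinchInv (cascade x n, cascadeState x (n + 1)) = (cascadeState x n, x (n + 1)) :=
  pinchInv_pinchFun _

theorem cascade_injective : Function.Injective cascade := by
  intro x x' h
  have key : ∀ k n, |(cascadeState x n : ℝ) - cascadeState x' n| ≤ (3 / 4) ^ k := by
    intro k
    induction k with
    | zero =>
      intro n
      have := (cascadeState x n).2
      have := (cascadeState x' n).2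
      simp only [mem_Icc] at *
      rw [abs_le]
      constructor <;> norm_num <;> linarith
    | succ k ih =>
      intro n
      have h1 := congrArg Prod.fst (pinchInv_cascade x n)
      have h2 := congrArg Prod.fst (pinchInv_cascade x' n)
      simp only at h1 h2
      rw [← h1, ← h2, h]
      refine (pinchInv_lipschitz _ _ _).trans ?_
      rw [pow_succ']
      exact mul_le_mul_of_nonneg_left (ih (n + 1)) (by norm_num)
  have hs : ∀ n, cascadeState x n = cascadeState x' n := by
    intro n
    apply Subtype.ext
    have : |(cascadeState x n : ℝ) - cascadeState x' n| ≤ 0 :=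
      ge_of_tendsto' (tendsto_pow_atTop_nhds_zero_of_lt_one (by norm_num) (by norm_num))
        fun k => key k n
    exact sub_eq_zero.1 (abs_nonpos_iff.1 this)
  funext n
  cases n with
  | zero => exact hs 0
  | succ n =>
    have h1 := congrArg Prod.snd (pinchInv_cascade x n)
    have h2 := congrArg Prod.snd (pinchInv_cascade x' n)
    simp only at h1 h2
    rw [← h1, ← h2, h, hs]

theorem exists_backward_orbit (w : ℕ → UI) :
    ∃ y : ℕ → UI, ∀ n, y n = (pinchInv (w n, y (n + 1))).1 := by
  have hfin : ∀ m : ℕ, ∀ w : ℕ → UI, ∃ y : ℕ → UI,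
      ∀ n < m, y n = (pinchInv (w n, y (n + 1))).1 := by
    intro m
    induction m with
    | zero => exact fun w => ⟨fun _ => 0, by simp⟩
    | succ m ih =>
      intro w
      obtain ⟨y, hy⟩ := ih fun n => w (n + 1)
      refine ⟨fun n => Nat.casesOn n (pinchInv (w 0, y 0)).1 y, fun n hn => ?_⟩
      cases n with
      | zero => rfl
      | succ n => exact hy n (by omega)
  have hcl : ∀ m : ℕ, IsClosed {y : ℕ → UI | ∀ n < m, y n = (pinchInv (w n, y (n + 1))).1} := by
    intro m
    simp only [Set.ofPred_forall]
    refine isClosed_iInter fun n => isClosed_iInter fun _ => isClosed_eq (continuous_apply n) ?_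
    exact continuous_fst.comp (continuous_pinchInv.comp (by fun_prop))
  obtain ⟨y, hy⟩ := IsCompact.nonempty_iInter_of_sequence_nonempty_isCompact_isClosed
    (fun m : ℕ => {y : ℕ → UI | ∀ n < m, y n = (pinchInv (w n, y (n + 1))).1})
    (fun m y hy n hn => hy n (by omega)) (fun m => hfin m w) (hcl 0).isCompact hcl
  rw [mem_iInter] at hy
  exact ⟨y, fun n => hy (n + 1) n (by omega)⟩

theorem cascade_surjective : Function.Surjective cascade := by
  intro w
  obtain ⟨y, hy⟩ := exists_backward_orbit w
  let x : ℕ → UI := fun n => Nat.casesOn n (y 0) fun n => (pinchInv (w n, y (n + 1))).2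
  have hx : ∀ n, (y n, x (n + 1)) = pinchInv (w n, y (n + 1)) := fun n => Prod.ext (hy n) rfl
  have hs : ∀ n, cascadeState x n = y n := by
    intro n
    induction n with
    | zero => rfl
    | succ n ih => rw [cascadeState, ih, hx, pinchFun_pinchInv]
  refine ⟨x, funext fun n => ?_⟩
  rw [cascade, hs, hx, pinchFun_pinchInv]

/-- The Hilbert cube has a homeomorphism moving a corner into the pseudo-interior. -/
theorem exists_homeomorph_corner :
    ∃ F : (ℕ → UI) ≃ₜ (ℕ → UI), F (fun _ => 0) = fun _ => half := by
  obtain ⟨F, hF⟩ := exists_homeomorph_of_bijective cascade continuous_cascade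
    ⟨cascade_injective, cascade_surjective⟩
  refine ⟨F, ?_⟩
  rw [hF]
  have hs : ∀ n, cascadeState (fun _ => 0) n = 0 := by
    intro n
    induction n with
    | zero => rfl
    | succ n ih => rw [cascadeState, ih, pinchFun_zero]
  funext n
  rw [cascade, hs, pinchFun_zero]

theorem exists_square_rotation : ∃ R : ℝ → UI × UI → UI × UI,
    Continuous (fun q : ℝ × (UI × UI) => R q.1 q.2) ∧ (∀ a, Function.Bijective (R a)) ∧
    ∀ p, ∃ a, ((R a p).1 : ℝ) ∈ Ioo (0:ℝ) 1 := by
  let s : Set ℂ := Icc (0:ℝ) 1 ×ℂ Icc (0:ℝ) 1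
  have hs_int : interior s = Ioo (0:ℝ) 1 ×ℂ Ioo (0:ℝ) 1 := by
    simp only [s, Complex.interior_reProdIm, interior_Icc]
  have hs_cl : closure s = s := by simp only [s, Complex.closure_reProdIm, closure_Icc]
  have hs_compact : IsCompact s := isCompact_Icc.reProdIm isCompact_Icc
  have hs_convex : Convex ℝ s := by
    rw [← convexHull_eq_self, Complex.convexHull_reProdIm, (convex_Icc 0 1).convexHull_eq]
  obtain ⟨e, h1, h2, -⟩ := exists_homeomorph_image_eq (s := s) (t := Metric.closedBall (0:ℂ) 1)
    hs_convex (by rw [hs_int]; exact ⟨⟨1 / 2, 1 / 2⟩, by norm_num [Complex.mem_reProdIm]⟩)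
    (NormedSpace.isVonNBounded_of_isBounded ℝ hs_compact.isBounded) (convex_closedBall _ _)
    (by rw [interior_closedBall _ one_ne_zero]; exact ⟨0, by simp⟩)
    (NormedSpace.isVonNBounded_closedBall ℝ ℂ 1)
  rw [hs_cl, Metric.isClosed_closedBall.closure_eq] at h2
  rw [interior_closedBall _ one_ne_zero] at h1
  let q : UI × UI → ℂ := fun p => ⟨p.1, p.2⟩
  have hq : Continuous q := by
    have : q = fun p => ((p.1 : ℝ) : ℂ) + ((p.2 : ℝ) : ℂ) * Complex.I := by
      funext p
      apply Complex.ext <;> simp [q]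
    rw [this]; fun_prop
  have hqs : ∀ p, q p ∈ s := fun p => Complex.mem_reProdIm.2 ⟨p.1.2, p.2.2⟩
  let r : ℂ → UI × UI := fun z =>
    (Set.projIcc 0 1 zero_le_one z.re, Set.projIcc 0 1 zero_le_one z.im)
  have hr : Continuous r := (continuous_projIcc.comp Complex.continuous_re).prodMk
    (continuous_projIcc.comp Complex.continuous_im)
  have hqr : ∀ z ∈ s, q (r z) = z := by
    intro z hz
    obtain ⟨ha, hb⟩ := Complex.mem_reProdIm.1 hz
    apply Complex.ext
    · simp only [q, r]; rw [Set.projIcc_of_mem _ ha]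
    · simp only [q, r]; rw [Set.projIcc_of_mem _ hb]
  have hrq : ∀ p, r (q p) = p := by
    intro p
    simp only [q, r, Set.projIcc_val]
  have hball : ∀ z, z ∈ s ↔ ‖e z‖ ≤ 1 := by
    intro z
    rw [← mem_closedBall_zero_iff, ← h2, e.injective.mem_set_image]
  have hinner : ∀ z, z ∈ interior s ↔ ‖e z‖ < 1 := by
    intro z
    rw [← mem_ball_zero_iff, ← h1, e.injective.mem_set_image]
  let R : ℝ → UI × UI → UI × UI := fun a p => r (e.symm (Complex.exp (a * Complex.I) * e (q p)))
  have hRs : ∀ (a : ℝ) p, e.symm (Complex.exp (a * Complex.I) * e (q p)) ∈ s := by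
    intro a p
    rw [hball, e.apply_symm_apply, norm_mul, Complex.norm_exp_ofReal_mul_I, one_mul]
    exact (hball _).1 (hqs p)
  have hinv : ∀ a p, R (-a) (R a p) = p := by
    intro a p
    simp only [R]
    rw [hqr _ (hRs a p), e.apply_symm_apply, ← mul_assoc, ← Complex.exp_add]
    simp [hrq]
  refine ⟨R, ?_, fun a => ⟨Function.LeftInverse.injective (hinv a),
    Function.RightInverse.surjective (g := R (-a)) fun t => by
      simpa using hinv (-a) t⟩, fun p => ?_⟩
  · exact hr.comp (e.symm.continuous.comp (by fun_prop))
  · rcases lt_or_eq_of_le ((hball _).1 (hqs p)) with h | h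
    · refine ⟨0, ?_⟩
      have : R 0 p = p := by simp [R, hrq]
      rw [this]
      have h3 := (hinner _).2 h
      rw [hs_int] at h3
      exact (Complex.mem_reProdIm.1 h3).1
    · have h4 : ‖e (q (half, 0))‖ = 1 := by
        refine le_antisymm ((hball _).1 (hqs _)) (not_lt.1 fun h5 => ?_)
        have h3 := (hinner _).2 h5
        rw [hs_int] at h3
        exact lt_irrefl _ (Complex.mem_reProdIm.1 h3).2.1
      refine ⟨Complex.arg (e (q (half, 0)) / e (q p)), ?_⟩
      have h6 : Complex.exp (Complex.arg (e (q (half, 0)) / e (q p)) * Complex.I) =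
          e (q (half, 0)) / e (q p) := by
        have := Complex.norm_mul_exp_arg_mul_I (e (q (half, 0)) / e (q p))
        rwa [norm_div, h, h4, div_one, Complex.ofReal_one, one_mul] at this
      have h7 : R (Complex.arg (e (q (half, 0)) / e (q p))) p = (half, 0) := by
        simp only [R]
        rw [h6, div_mul_cancel₀, e.symm_apply_apply, hrq]
        intro h0
        rw [h0] at h
        simp at h
      rw [h7, half_coe]
      norm_num

theorem exists_continuous_choice {C : Type*} [TopologicalSpace C] [CompactSpace C] [T2Space C]
    [TotallyDisconnectedSpace C] (P : ℝ → C → Prop) (ho : ∀ a, IsOpen {c | P a c})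
    (hP : ∀ c, ∃ a, P a c) : ∃ a : C → ℝ, Continuous a ∧ ∀ c, P (a c) c := by
  classical
  have hU : TopologicalSpace.IsOpenCover
      (fun a : ℝ => (⟨{c | P a c}, ho a⟩ : TopologicalSpace.Opens C)) := by
    exact TopologicalSpace.IsOpenCover.of_sets (v := fun a => {c | P a c}) ho
      (eq_univ_of_forall fun c => mem_iUnion.2 (hP c))
  obtain ⟨n, W, hW, hc, hd⟩ := hU.exists_finite_nonempty_disjoint_clopen_cover
  choose b hb using fun j => (hW j).2
  refine ⟨fun c => ∑ j, (W j : Set C).indicator (fun _ => b j) c,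
    continuous_finsetSum _ fun j _ => ?_, fun c => ?_⟩
  · exact continuous_const.indicator (by simp [(W j).isClopen.frontier_eq])
  · obtain ⟨j, hj⟩ := mem_iUnion.1 (hc (mem_univ c))
    have : ∑ j, (W j : Set C).indicator (fun _ => b j) c = b j := by
      rw [Finset.sum_eq_single j, indicator_of_mem hj]
      · intro i _ hij
        refine indicator_of_notMem (fun hi => ?_) _
        have : c ∈ (W i ⊓ W j : TopologicalSpace.Clopens C) := ⟨hi, hj⟩
        rw [disjoint_iff.1 (hd hij)] at this
        exact this
      · simp
    simp only [this]
    exact hb j hj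

/-- The Hilbert cube with one distinguished coordinate and the others grouped in pairs. -/
abbrev PairedCube : Type := UI × (ℕ → UI × UI)

section
variable {C : Type} [TopologicalSpace C] [CompactSpace C]

theorem exists_homeomorph_fiberwise (e0 : C → UI) (he : Continuous e0)
    (hi : Function.Injective e0) (Ψ : ℝ → UI × UI → UI × UI)
    (hΨ : Continuous (fun q : ℝ × (UI × UI) => Ψ q.1 q.2)) (hb : ∀ a, Function.Bijective (Ψ a))
    (a : C → ℕ → ℝ) (ha : Continuous a) :
    ∃ H : PairedCube ≃ₜ PairedCube, ∀ c p, H (e0 c, p) = (e0 c, fun n => Ψ (a c n) (p n)) := by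
  obtain ⟨g, hg⟩ := ContinuousMap.exists_extension'
    (he.isClosedEmbedding hi) (⟨a, ha⟩ : C(C, ℕ → ℝ))
  obtain ⟨H, hH⟩ := exists_homeomorph_shear (Y := UI) (Z := ℕ → UI × UI)
    (fun x p n => Ψ (g x n) (p n))
    (by
      refine continuous_pi fun n => ?_
      have h1 : Continuous fun p : UI × (ℕ → UI × UI) => (g p.1 n, p.2 n) := by
        have := g.continuous
        fun_prop
      exact hΨ.comp h1)
    (fun x => by
      refine ⟨fun p p' h => ?_, fun p => ?_⟩
      · funext n
        exact (hb _).1 (congrFun h n)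
      · choose q hq using fun n => (hb (g x n)).2 (p n)
        exact ⟨q, funext hq⟩)
  refine ⟨H, fun c p => ?_⟩
  rw [hH]
  have : g (e0 c) = a c := congrFun hg c
  rw [this]

/-- The splitting of a sequence of pairs into a pair of sequences. -/
def unzipHomeomorph : (ℕ → UI × UI) ≃ₜ (ℕ → UI) × (ℕ → UI) where
  toFun q := (fun n => (q n).1, fun n => (q n).2)
  invFun p n := (p.1 n, p.2 n)
  left_inv _ := rfl
  right_inv _ := rfl
  continuous_toFun := by fun_prop
  continuous_invFun := by fun_prop

theorem exists_homeomorph_seconds_interior : ∃ K : (ℕ → UI × UI) ≃ₜ (ℕ → UI × UI),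
    ∃ t' : UI → UI, Continuous t' ∧ (∀ t, (t' t : ℝ) ∈ Ioo (0:ℝ) 1) ∧
      ∀ t : ℕ → UI, K (fun n => (half, t n)) = fun n => (half, t' (t n)) := by
  obtain ⟨F, hF⟩ := exists_homeomorph_corner
  obtain ⟨T, hT⟩ := exists_homeomorph_bottom_interior
  let A : (ℕ → UI × UI) ≃ₜ (ℕ → UI × UI) :=
    unzipHomeomorph.trans ((F.prodCongr (Homeomorph.refl _)).trans unzipHomeomorph.symm)
  have hA : ∀ t : ℕ → UI, A (fun n => (0, t n)) = fun n => (half, t n) := by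
    intro t
    change (fun n => (F (fun _ => 0) n, t n)) = _
    rw [hF]
  let B : (ℕ → UI × UI) ≃ₜ (ℕ → UI × UI) := Homeomorph.piCongrRight fun _ =>
    (Homeomorph.prodComm UI UI).trans (T.trans (Homeomorph.prodComm UI UI))
  have hB : ∀ t : ℕ → UI, B (fun n => (0, t n)) = fun n => (0, (T (t n, 0)).1) := by
    intro t
    funext n
    change ((T (t n, 0)).2, (T (t n, 0)).1) = _
    rw [(hT _).2]
  refine ⟨A.symm.trans (B.trans A), fun t => (T (t, 0)).1, by fun_prop, fun t => (hT t).1,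
    fun t => ?_⟩
  simp only [Homeomorph.trans_apply]
  rw [← hA, A.symm_apply_apply, hB, hA fun n => (T (t n, 0)).1]

variable [T2Space C]

theorem exists_homeomorph_straighten [TotallyDisconnectedSpace C] (e0 : C → UI)
    (he : Continuous e0) (hi : Function.Injective e0) (p : C → ℕ → UI × UI) (hp : Continuous p) :
    ∃ H : PairedCube ≃ₜ PairedCube, ∀ c, H (e0 c, p c) = (e0 c, fun _ => (half, half)) := by
  obtain ⟨R, hR, hRb, hRi⟩ := exists_square_rotation
  have hRc : ∀ n a, Continuous fun c => R a (p c n) := fun n a =>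
    hR.comp (f := fun c => (a, p c n)) (by fun_prop)
  choose a ha hai using fun n => exists_continuous_choice
    (fun r c => ((R r (p c n)).1 : ℝ) ∈ Ioo (0:ℝ) 1)
    (fun r => isOpen_Ioo.preimage (continuous_subtype_val.comp (continuous_fst.comp (hRc n r))))
    (fun c => hRi (p c n))
  obtain ⟨H1, hH1⟩ := exists_homeomorph_fiberwise e0 he hi R hR hRb (fun c n => a n c)
    (continuous_pi ha)
  have hp1 : ∀ n, Continuous fun c => R (a n c) (p c n) := fun n =>
    hR.comp (f := fun c => (a n c, p c n)) ((ha n).prodMk (by fun_prop))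
  obtain ⟨H2, hH2⟩ := exists_homeomorph_fiberwise e0 he hi (fun r q => (mobius r q.1, q.2))
    (by
      have : Continuous fun q : ℝ × (UI × UI) => mobius q.1 q.2.1 :=
        continuous_mobius.comp (f := fun q : ℝ × (UI × UI) => (q.1, q.2.1)) (by fun_prop)
      fun_prop)
    (fun r => (mobius_bijective r).prodMap Function.bijective_id)
    (fun c n => logit half - logit (R (a n c) (p c n)).1)
    (continuous_pi fun n => continuous_const.sub
      (continuous_logit_comp _ (continuous_fst.comp (hp1 n)) (hai n)))
  obtain ⟨K, t', ht', hti, hK⟩ := exists_homeomorph_seconds_interior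
  have ht2 : ∀ n, Continuous fun c => t' (R (a n c) (p c n)).2 := fun n =>
    ht'.comp (continuous_snd.comp (hp1 n))
  obtain ⟨H4, hH4⟩ := exists_homeomorph_fiberwise e0 he hi (fun r q => (q.1, mobius r q.2))
    (by
      have : Continuous fun q : ℝ × (UI × UI) => mobius q.1 q.2.2 :=
        continuous_mobius.comp (f := fun q : ℝ × (UI × UI) => (q.1, q.2.2)) (by fun_prop)
      fun_prop)
    (fun r => Function.bijective_id.prodMap (mobius_bijective r))
    (fun c n => logit half - logit (t' (R (a n c) (p c n)).2))
    (continuous_pi fun n => continuous_const.sub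
      (continuous_logit_comp _ (ht2 n) fun _ => hti _))
  have hhalf : (half : ℝ) ∈ Ioo (0:ℝ) 1 := by rw [half_coe]; norm_num
  refine ⟨H1.trans (H2.trans (((Homeomorph.refl UI).prodCongr K).trans H4)), fun c => ?_⟩
  simp only [Homeomorph.trans_apply, hH1, hH2]
  have h3 : (fun n => (mobius (logit half - logit (R (a n c) (p c n)).1) (R (a n c) (p c n)).1,
      (R (a n c) (p c n)).2)) = fun n => (half, (R (a n c) (p c n)).2) := by
    funext n
    rw [mobius_logit _ _ (hai n c) hhalf]
  rw [h3]
  change H4 (e0 c, K (fun n => (half, (R (a n c) (p c n)).2))) = _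
  rw [hK, hH4]
  simp only [mobius_logit _ _ (hti _) hhalf]

/-- The exchange of the distinguished coordinate with another one. -/
def exchangeHomeomorph : PairedCube ≃ₜ PairedCube where
  toFun x := ((x.2 0).1, Function.update x.2 0 (x.1, (x.2 0).2))
  invFun x := ((x.2 0).1, Function.update x.2 0 (x.1, (x.2 0).2))
  left_inv x := by simp
  right_inv x := by simp
  continuous_toFun := by fun_prop
  continuous_invFun := by fun_prop

theorem exists_homeomorph_paired [TotallyDisconnectedSpace C] (e e' : C → PairedCube)
    (he : Continuous e) (he' : Continuous e') (hi : Function.Injective fun c => (e c).1)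
    (hi' : Function.Injective fun c => (e' c).1) :
    ∃ H : PairedCube ≃ₜ PairedCube, ∀ c, H (e c) = e' c := by
  have hc1 : Continuous fun c => (e c).1 := by fun_prop
  have hc1' : Continuous fun c => (e' c).1 := by fun_prop
  obtain ⟨A, hA⟩ := exists_homeomorph_straighten _ hc1 hi (fun c => (e c).2) (by fun_prop)
  obtain ⟨B, hB⟩ := exists_homeomorph_straighten _ hc1 hi (fun c _ => ((e' c).1, half))
    (by fun_prop)
  obtain ⟨A', hA'⟩ := exists_homeomorph_straighten _ hc1' hi' (fun c => (e' c).2) (by fun_prop)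
  obtain ⟨B', hB'⟩ := exists_homeomorph_straighten _ hc1' hi'
    (fun c => Function.update (fun _ => ((e' c).1, half)) 0 ((e c).1, half))
    (by
      have : Continuous fun c => ((e c).1, half) := by fun_prop
      exact Continuous.update (by fun_prop) 0 this)
  refine ⟨A.trans (B.symm.trans (exchangeHomeomorph.trans (B'.trans A'.symm))), fun c => ?_⟩
  simp only [Homeomorph.trans_apply]
  rw [show e c = ((e c).1, (e c).2) from rfl, hA, ← hB, B.symm_apply_apply]
  change A'.symm (B' ((e' c).1, Function.update (fun _ => ((e' c).1, half)) 0 ((e c).1, half))) = _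
  rw [hB', ← hA', A'.symm_apply_apply]

/-- The regrouping of coordinates of the Hilbert cube. -/
def pairingHomeomorph : HilbertCube ≃ₜ PairedCube where
  toFun x := (x 0, fun n => (x (2 * n + 1), x (2 * n + 2)))
  invFun p n := if n = 0 then p.1 else if n % 2 = 1 then (p.2 (n / 2)).1 else (p.2 (n / 2 - 1)).2
  left_inv x := by
    funext n
    rcases Nat.eq_zero_or_pos n with rfl | hn
    · simp
    · rcases Nat.even_or_odd' n with ⟨k, rfl | rfl⟩
      · have h1 : 2 * (k - 1) + 2 = 2 * k := by omega
        simp [h1, hn.ne']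
      · have h1 : (2 * k + 1) / 2 = k := by omega
        have h2 : (2 * k + 1) % 2 = 1 := by omega
        simp [h1, h2]
  right_inv p := by
    refine Prod.ext (by simp) (funext fun n => ?_)
    have h1 : (2 * n + 1) / 2 = n := by omega
    have h2 : (2 * n + 1) % 2 = 1 := by omega
    have h3 : (2 * n + 2) / 2 - 1 = n := by omega
    have h4 : ¬ (2 * n + 2) % 2 = 1 := by omega
    simp [h1, h2]
  continuous_toFun := by fun_prop
  continuous_invFun := by
    refine continuous_pi fun n => ?_
    split_ifs <;> fun_prop

/-- Compact zero-dimensional embeddings into the Hilbert cube with injective zeroth coordinate are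
ambiently equivalent. -/
theorem exists_homeomorph_cube [TotallyDisconnectedSpace C] (e e' : C → HilbertCube)
    (he : Continuous e) (he' : Continuous e') (hi : Function.Injective fun c => e c 0)
    (hi' : Function.Injective fun c => e' c 0) :
    ∃ H : HilbertCube ≃ₜ HilbertCube, ∀ c, H (e c) = e' c := by
  obtain ⟨H, hH⟩ := exists_homeomorph_paired (fun c => pairingHomeomorph (e c))
    (fun c => pairingHomeomorph (e' c)) (by fun_prop) (by fun_prop) hi hi'
  refine ⟨pairingHomeomorph.trans (H.trans pairingHomeomorph.symm), fun c => ?_⟩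
  simp only [Homeomorph.trans_apply, hH, Homeomorph.symm_apply_apply]

end

/-- An embedding of the Cantor cube in the open unit interval. -/
noncomputable def cantorEmb (z : ℕ → Bool) : UI :=
  ⟨(1 + (cantorSetHomeomorphNatToBool.symm z : ℝ)) / 3, by
    have := cantorSet_subset_unitInterval (cantorSetHomeomorphNatToBool.symm z).2
    constructor <;> linarith [this.1, this.2]⟩

theorem cantorEmb_mem (z : ℕ → Bool) : (cantorEmb z : ℝ) ∈ Ioo (0:ℝ) 1 := by
  have := cantorSet_subset_unitInterval (cantorSetHomeomorphNatToBool.symm z).2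
  constructor <;> simp only [cantorEmb] <;> linarith [this.1, this.2]

theorem continuous_cantorEmb : Continuous cantorEmb := by
  unfold cantorEmb
  fun_prop

theorem cantorEmb_injective : Function.Injective cantorEmb := by
  intro z z' h
  have h1 : (1 + (cantorSetHomeomorphNatToBool.symm z : ℝ)) / 3 =
    (1 + (cantorSetHomeomorphNatToBool.symm z' : ℝ)) / 3 := congrArg Subtype.val h
  apply cantorSetHomeomorphNatToBool.symm.injective
  apply Subtype.ext
  linarith

/-- The standard Cantor set in the Hilbert cube. -/
noncomputable def stdCantor (z : ℕ → Bool) : HilbertCube :=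
  Function.update (fun _ => half) 0 (cantorEmb z)

theorem stdCantor_zero (z : ℕ → Bool) : stdCantor z 0 = cantorEmb z := by simp [stdCantor]

theorem continuous_stdCantor : Continuous stdCantor := by
  unfold stdCantor
  exact continuous_const.update 0 continuous_cantorEmb

theorem stdCantor_injective_zero : Function.Injective fun z => stdCantor z 0 := by
  simpa only [stdCantor_zero] using cantorEmb_injective

/-- A continuous real function on the Cantor cube with uncountable image is injective on some
Cantor set. -/
theorem exists_cantor_injective_comp (f : (ℕ → Bool) → UI) (hf : Continuous f)
    (hu : ¬ (range f).Countable) :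
    ∃ s : (ℕ → Bool) → (ℕ → Bool), Continuous s ∧ Function.Injective (f ∘ s) := by
  have hcomp : IsCompact (range f) := isCompact_range hf
  have hne : ∀ y : range f, (f ⁻¹' {(y : UI)}).Nonempty := fun y => by
    obtain ⟨z, hz⟩ := y.2
    exact ⟨z, hz⟩
  have hcl : ∀ y : range f, IsCompact (f ⁻¹' {(y : UI)}) := fun y =>
    (isClosed_singleton.preimage hf).isCompact
  choose m hm hmin using fun y => (hcl y).exists_isMinOn (hne y)
    (continuous_subtype_val.comp continuous_cantorEmb).continuousOn
  have hmeas : Measurable fun y => (cantorEmb (m y) : ℝ) := by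
    refine measurable_of_Iic fun a => IsClosed.measurableSet ?_
    have : (fun y => (cantorEmb (m y) : ℝ)) ⁻¹' Iic a =
        Subtype.val ⁻¹' (f '' {z | (cantorEmb z : ℝ) ≤ a}) := by
      ext y
      constructor
      · exact fun h => ⟨m y, h, hm y⟩
      · rintro ⟨z, hz, hzy⟩
        exact (isMinOn_iff.1 (hmin y) z hzy).trans hz
    rw [this]
    refine IsClosed.preimage continuous_subtype_val (IsCompact.isClosed (IsCompact.image ?_ hf))
    exact (isClosed_le (continuous_subtype_val.comp continuous_cantorEmb)
      continuous_const).isCompact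
  have hP : PolishSpace (range f) := hcomp.isClosed.polishSpace
  obtain ⟨t', ht', hct, hpol⟩ := hmeas.exists_continuous
  have hun : ¬ (Set.univ : Set (range f)).Countable := by
    rwa [Set.countable_univ_iff, Set.countable_coe_iff]
  obtain ⟨φ, -, hφc, hφi⟩ := @IsClosed.exists_nat_bool_injection_of_not_countable _ t' hpol
    Set.univ isClosed_univ hun
  refine ⟨fun z => m (φ z), ?_, fun z z' h => ?_⟩
  · have hE : IsEmbedding fun z => (cantorEmb z : ℝ) :=
      IsEmbedding.subtypeVal.comp
        (continuous_cantorEmb.isClosedEmbedding cantorEmb_injective).isEmbedding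
    rw [hE.continuous_iff]
    exact @Continuous.comp _ _ _ _ t' _ _ _ hct hφc
  · apply hφi
    apply Subtype.ext
    have h1 : f (m (φ z)) = φ z := hm (φ z)
    have h2 : f (m (φ z')) = φ z' := hm (φ z')
    rw [← h1, ← h2]
    exact h

/-- The exchange of the zeroth and the `i`th coordinates. -/
def swapHomeomorph (i : ℕ) : HilbertCube ≃ₜ HilbertCube where
  toFun x n := x (Equiv.swap 0 i n)
  invFun x n := x (Equiv.swap 0 i n)
  left_inv x := by simp
  right_inv x := by simp
  continuous_toFun := by fun_prop
  continuous_invFun := by fun_prop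

theorem swapHomeomorph_zero (i : ℕ) (x : HilbertCube) : swapHomeomorph i x 0 = x i := by
  change x (Equiv.swap 0 i 0) = _
  rw [Equiv.swap_apply_left]

theorem exists_homeomorph_square_interior (p : UI × UI) :
    ∃ ρ : (UI × UI) ≃ₜ (UI × UI), ((ρ p).1 : ℝ) ∈ Ioo (0:ℝ) 1 := by
  obtain ⟨R, hR, hRb, hRi⟩ := exists_square_rotation
  obtain ⟨a, ha⟩ := hRi p
  obtain ⟨H, hH⟩ := exists_homeomorph_of_bijective (R a)
    (hR.comp (f := fun p => (a, p)) (by fun_prop)) (hRb a)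
  exact ⟨H, by rwa [hH]⟩

theorem exists_homeomorph_of_const (j : (ℕ → Bool) → HilbertCube) (hj : Continuous j)
    (hi : Function.Injective j) (c : UI) (hc : (c : ℝ) ∈ Ioo (0:ℝ) 1) (hjc : ∀ z, j z 1 = c) :
    ∃ G : HilbertCube ≃ₜ HilbertCube, Function.Injective fun z => G (j z) 0 := by
  let D : HilbertCube ≃ₜ UI × ({n : ℕ // n ≠ 1} → UI) := Homeomorph.funSplitAt UI 1
  have hD : ∀ z, D (j z) = (c, (D (j z)).2) := fun z => Prod.ext (hjc z) rfl
  have hi2 : Function.Injective fun z => (D (j z)).2 := by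
    intro z z' h
    apply hi
    apply D.injective
    rw [hD z, hD z']
    exact congrArg _ h
  have hc2 : Continuous fun z => (D (j z)).2 := by fun_prop
  have hl : Continuous fun z => logit (cantorEmb z) - logit c :=
    (continuous_logit_comp _ continuous_cantorEmb cantorEmb_mem).sub continuous_const
  obtain ⟨g, hg⟩ := ContinuousMap.exists_extension' (hc2.isClosedEmbedding hi2)
    (⟨_, hl⟩ : C(ℕ → Bool, ℝ))
  obtain ⟨S, hS⟩ := exists_homeomorph_shear (Y := {n : ℕ // n ≠ 1} → UI) (Z := UI)
    (fun y t => mobius (g y) t)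
    (continuous_mobius.comp (f := fun p : ({n : ℕ // n ≠ 1} → UI) × UI => (g p.1, p.2))
      (by have := g.continuous; fun_prop))
    (fun y => mobius_bijective _)
  let G1 : HilbertCube ≃ₜ HilbertCube := D.trans ((Homeomorph.prodComm _ _).trans
    (S.trans ((Homeomorph.prodComm _ _).trans D.symm)))
  have hG1 : ∀ z, G1 (j z) 1 = cantorEmb z := by
    intro z
    have h1 : G1 (j z) 1 = (D (G1 (j z))).1 := rfl
    have h2 : D (G1 (j z)) = Prod.swap (S (Prod.swap (D (j z)))) := by
      simp [G1]
    have h3 : g (D (j z)).2 = logit (cantorEmb z) - logit c := congrFun hg z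
    rw [h1, h2, hD, Prod.swap_prod_mk, hS, Prod.swap_prod_mk]
    simp only [h3]
    exact mobius_logit _ _ hc (cantorEmb_mem z)
  refine ⟨G1.trans (swapHomeomorph 1), ?_⟩
  intro z z' h
  simp only [Homeomorph.trans_apply, swapHomeomorph_zero, hG1] at h
  exact cantorEmb_injective h

theorem exists_good_cantor_subset (B : Set HilbertCube) (hB : IsCantorSet B) :
    ∃ j : (ℕ → Bool) → HilbertCube, Continuous j ∧ (∀ z, j z ∈ B) ∧
      ∃ G : HilbertCube ≃ₜ HilbertCube, Function.Injective fun z => G (j z) 0 := by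
  obtain ⟨K⟩ := hB
  have hKc : Continuous fun z => (K.symm z : HilbertCube) := by fun_prop
  by_cases h : ∃ i, ¬ (range fun z => (K.symm z : HilbertCube) i).Countable
  · obtain ⟨i, hi⟩ := h
    obtain ⟨s, hs, hsi⟩ := exists_cantor_injective_comp _ ((continuous_apply i).comp hKc) hi
    refine ⟨fun z => K.symm (s z), by fun_prop, fun z => (K.symm (s z)).2, swapHomeomorph i, ?_⟩
    simp only [swapHomeomorph_zero]
    exact hsi
  · push Not at h
    have hBc : IsClosed B := by
      have : B = range fun z => (K.symm z : HilbertCube) := by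
        ext x
        constructor
        · exact fun hx => ⟨K ⟨x, hx⟩, by simp⟩
        · rintro ⟨z, rfl⟩
          exact (K.symm z).2
      rw [this]
      exact (isCompact_range hKc).isClosed
    have hBu : ¬ B.Countable := by
      rw [← Set.countable_coe_iff, K.toEquiv.countable_iff]
      intro hcount
      have := Cardinal.mk_le_aleph0_iff.2 hcount
      simp only [mk_pi, mk_bool, prod_const, lift_id] at this
      simp only [mk_nat, two_power_aleph0] at this
      exact absurd this (not_le.2 aleph0_lt_continuum)
    obtain ⟨a, b, hab⟩ : ∃ a b, ¬ (B ∩ {x | x 1 = a ∧ x 2 = b}).Countable := by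
      by_contra! hcon
      apply hBu
      refine Countable.mono (s₂ := ⋃ a ∈ range (fun z => (K.symm z : HilbertCube) 1),
        ⋃ b ∈ range (fun z => (K.symm z : HilbertCube) 2), B ∩ {x | x 1 = a ∧ x 2 = b})
        (fun x hx => ?_) ((h 1).biUnion fun a _ => (h 2).biUnion fun b _ => hcon a b)
      simp only [mem_iUnion]
      exact ⟨x 1, ⟨K ⟨x, hx⟩, by simp⟩, x 2, ⟨K ⟨x, hx⟩, by simp⟩, hx, rfl, rfl⟩
    obtain ⟨j, hjr, hj, hji⟩ := IsClosed.exists_nat_bool_injection_of_not_countable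
      (hBc.inter ((isClosed_eq (continuous_apply 1) continuous_const).inter
        (isClosed_eq (continuous_apply 2) continuous_const))) hab
    have hjB : ∀ z, j z ∈ B ∧ j z 1 = a ∧ j z 2 = b := fun z => hjr (mem_range_self z)
    obtain ⟨ρ, hρ⟩ := exists_homeomorph_square_interior (a, b)
    let G1 : HilbertCube ≃ₜ HilbertCube := pairingHomeomorph.trans
      (((Homeomorph.refl UI).prodCongr (Homeomorph.piCongrRight fun _ => ρ)).trans
        pairingHomeomorph.symm)
    have hG1 : ∀ z, G1 (j z) 1 = (ρ (a, b)).1 := by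
      intro z
      have h1 : G1 (j z) 1 = (ρ (j z 1, j z 2)).1 := rfl
      rw [h1, (hjB z).2.1, (hjB z).2.2]
    obtain ⟨G2, hG2⟩ := exists_homeomorph_of_const (fun z => G1 (j z)) (by fun_prop)
      (G1.injective.comp hji) _ hρ hG1
    exact ⟨j, hj, fun z => (hjB z).1, G1.trans G2, hG2⟩

theorem isMinimalCantorSet_range_stdCantor : IsMinimalCantorSet (range stdCantor) := by
  refine ⟨⟨?_⟩, fun B hB => ?_⟩
  · exact ((continuous_stdCantor.isClosedEmbedding
      (fun z z' h => stdCantor_injective_zero (congrFun h 0))).isEmbedding.toHomeomorph).symm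
  · obtain ⟨j, hj, hjB, G, hG⟩ := exists_good_cantor_subset B hB
    obtain ⟨H, hH⟩ := exists_homeomorph_cube stdCantor (fun z => G (j z)) continuous_stdCantor
      (by fun_prop) stdCantor_injective_zero hG
    refine ⟨H.trans G.symm, ?_⟩
    rintro _ ⟨_, ⟨z, rfl⟩, rfl⟩
    simp only [Homeomorph.trans_apply, hH, Homeomorph.symm_apply_apply]
    exact hjB z

theorem IsMinimalCantorSet.preimage {A : Set HilbertCube} (hA : IsMinimalCantorSet A)
    (H : HilbertCube ≃ₜ HilbertCube) : IsMinimalCantorSet (H ⁻¹' A) := by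
  obtain ⟨⟨K⟩, hm⟩ := hA
  refine ⟨⟨(H.sets (t := A) rfl).trans K⟩, fun B hB => ?_⟩
  obtain ⟨h, hh⟩ := hm B hB
  refine ⟨H.trans h, ?_⟩
  rintro _ ⟨x, hx, rfl⟩
  exact hh ⟨H x, hx, rfl⟩

theorem exists_homeomorph_update (V : HilbertCube → ℝ) (hV : Continuous V)
    (hm : ∀ x, StrictMono fun t : UI => V (Function.update x 0 t))
    (h0 : ∀ x, V (Function.update x 0 0) = 0) (h1 : ∀ x, V (Function.update x 0 1) = 1) :
    ∃ H : HilbertCube ≃ₜ HilbertCube, ∀ x, (H x 0 : ℝ) = V x := by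
  have hI : ∀ x, V x ∈ Icc (0:ℝ) 1 := by
    intro x
    have e : V x = V (Function.update x 0 (x 0)) := by rw [Function.update_eq_self]
    refine ⟨?_, ?_⟩
    · exact (h0 x).symm.trans_le (((hm x).monotone bot_le).trans_eq e.symm)
    · exact e.trans_le (((hm x).monotone le_top).trans_eq (h1 x))
  obtain ⟨H, hH⟩ := exists_homeomorph_of_bijective
    (fun x : HilbertCube => Function.update x 0 (⟨V x, hI x⟩ : UI))
    (continuous_id.update 0 (by fun_prop)) (by
      constructor
      · intro x y h
        have ht : y = Function.update x 0 (y 0) := by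
          ext n
          rcases eq_or_ne n 0 with rfl | hn
          · simp
          · have := congrFun h n
            simp only [Function.update_of_ne hn] at this
            simp [Function.update_of_ne hn, this]
        have hv : V x = V y := by
          have := congrFun h 0
          simpa using this
        have e : V x = V (Function.update x 0 (x 0)) := by rw [Function.update_eq_self]
        rw [ht, e] at hv
        have := (hm x).injective hv
        rw [ht, ← this, Function.update_eq_self]
      · intro y
        have hc : Continuous fun t : UI => V (Function.update y 0 t) :=
          hV.comp (continuous_const.update 0 continuous_id)
        obtain ⟨t, ht⟩ := mem_range_of_exists_le_of_exists_ge hc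
          ⟨0, (h0 y).trans_le (y 0).2.1⟩ ⟨1, (y 0).2.2.trans_eq (h1 y).symm⟩
        refine ⟨Function.update y 0 t, ?_⟩
        ext n
        rcases eq_or_ne n 0 with rfl | hn
        · simpa using ht
        · simp [Function.update_of_ne hn])
  exact ⟨H, fun x => by simp [hH]⟩

/-- The piecewise linear function equal to `0` before `p` and to `1` after `q`. -/
noncomputable def ramp (p q x : ℝ) : ℝ := max 0 (min 1 ((x - p) / (q - p)))

theorem continuous_ramp (p q : ℝ) : Continuous (ramp p q) := by
  unfold ramp
  fun_prop

theorem ramp_nonneg (p q x : ℝ) : 0 ≤ ramp p q x := le_max_left _ _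

theorem ramp_le_one (p q x : ℝ) : ramp p q x ≤ 1 := max_le zero_le_one (min_le_left _ _)

theorem ramp_of_le {p q x : ℝ} (h : p < q) (hx : x ≤ p) : ramp p q x = 0 :=
  max_eq_left ((min_le_right _ _).trans
    (div_nonpos_of_nonpos_of_nonneg (by linarith) (by linarith)))

theorem ramp_of_ge {p q x : ℝ} (h : p < q) (hx : q ≤ x) : ramp p q x = 1 := by
  have : 1 ≤ (x - p) / (q - p) := by rw [one_le_div (by linarith)]; linarith
  rw [ramp, min_eq_left this]
  exact max_eq_right zero_le_one

theorem ramp_mono {p q : ℝ} (h : p < q) : Monotone (ramp p q) := fun x y hxy =>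
  max_le_max le_rfl (min_le_min le_rfl
    (div_le_div_of_nonneg_right (by linarith) (by linarith)))

/-- The sequence of intervals `(p k, q k)` consists of intervals disjoint from `C` and every
nondegenerate interval contains one of them. -/
def IsGapSequence (C : Set UI) (p q : ℕ → ℝ) : Prop :=
  (∀ k, 0 ≤ p k ∧ p k < q k ∧ q k ≤ 1) ∧ (∀ k, ∀ x ∈ C, (x : ℝ) ≤ p k ∨ q k ≤ x) ∧
    ∀ x y : UI, x < y → ∃ k, x ≤ p k ∧ q k ≤ y

theorem exists_gapSequence (C : Set UI) (hC : IsClosed C) (hi : interior C = ∅) :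
    ∃ p q, IsGapSequence C p q := by
  let S : Set (ℚ × ℚ) := {r | (0 ≤ (r.1:ℝ) ∧ (r.1:ℝ) < r.2 ∧ (r.2:ℝ) ≤ 1) ∧
    ∀ x ∈ C, (x : ℝ) ≤ r.1 ∨ (r.2:ℝ) ≤ x}
  have key : ∀ x y : UI, x < y → ∃ r ∈ S, (x:ℝ) ≤ r.1 ∧ (r.2:ℝ) ≤ y := by
    intro x y hxy
    have hne : (Ioo x y \ C).Nonempty := by
      by_contra hcon
      rw [not_nonempty_iff_eq_empty, sdiff_eq_empty] at hcon
      obtain ⟨z, hz⟩ := exists_between hxy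
      have : z ∈ interior C := mem_interior.2 ⟨_, hcon, isOpen_Ioo, hz⟩
      rw [hi] at this
      exact this
    obtain ⟨z, ⟨hz1, hz2⟩, hzC⟩ := hne
    obtain ⟨ε, hε, hb⟩ := Metric.isOpen_iff.1 hC.isOpen_compl z hzC
    have hz2' : (z:ℝ) < y := hz2
    obtain ⟨r, hr1, hr2⟩ := exists_rat_btwn (lt_min hz2' (lt_add_of_pos_right (z:ℝ) hε))
    obtain ⟨s, hs1, hs2⟩ := exists_rat_btwn hr1
    have hz1' : (x:ℝ) < z := hz1
    rw [lt_min_iff] at hr2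
    refine ⟨(s, r), ⟨⟨?_, hs2, ?_⟩, fun c hc => ?_⟩, ?_, ?_⟩
    · exact (z.2.1.trans_lt hs1).le
    · exact hr2.1.le.trans y.2.2
    · by_contra! h
      refine hb ?_ hc
      rw [Metric.mem_ball, Subtype.dist_eq, Real.dist_eq, abs_lt]
      simp only at h
      constructor <;> linarith
    · simp only; linarith
    · exact hr2.1.le
  have hne : S.Nonempty := by
    obtain ⟨r, hr, -⟩ := key 0 1 zero_lt_one
    exact ⟨r, hr⟩
  obtain ⟨f, hf⟩ := S.to_countable.exists_eq_range hne
  have hfS : ∀ k, f k ∈ S := fun k => hf ▸ mem_range_self k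
  refine ⟨fun k => (f k).1, fun k => (f k).2, fun k => (hfS k).1, fun k => (hfS k).2,
    fun x y hxy => ?_⟩
  obtain ⟨r, hr, h⟩ := key x y hxy
  rw [hf] at hr
  obtain ⟨k, rfl⟩ := hr
  exact ⟨k, h⟩

theorem exists_pos_bounds (C : Set UI) (hC : IsClosed C) (h : ∀ x ∈ C, (x : ℝ) ∈ Ioo (0:ℝ) 1) :
    ∃ a b : ℝ, 0 < a ∧ a ≤ 1 ∧ 0 ≤ b ∧ b < 1 ∧ ∀ x ∈ C, a ≤ x ∧ x ≤ b := by
  rcases C.eq_empty_or_nonempty with rfl | hne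
  · exact ⟨1, 0, by norm_num, le_rfl, le_rfl, by norm_num, by simp⟩
  · obtain ⟨a, ha⟩ := hC.isCompact.exists_isLeast hne
    obtain ⟨b, hb⟩ := hC.isCompact.exists_isGreatest hne
    exact ⟨a, b, (h a ha.1).1, a.2.2, b.2.1, (h b hb.1).2, fun x hx => ⟨ha.2 hx, hb.2 hx⟩⟩

/-- The coordinate examined by the `n`th digit of the code of a point. -/
def digitCoord (n : ℕ) : ℕ := if Even n then 0 else (n / 2).unpair.1 + 1

/-- The gap examined by the `n`th digit of the code of a point. -/
def digitGap (n : ℕ) : ℕ := if Even n then n / 2 else (n / 2).unpair.2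

theorem digitCoord_even (k : ℕ) : digitCoord (2 * k) = 0 := by simp [digitCoord]

theorem digitGap_even (k : ℕ) : digitGap (2 * k) = k := by simp [digitGap]

theorem digitCoord_odd (k : ℕ) : digitCoord (2 * k + 1) = k.unpair.1 + 1 := by
  have : (2 * k + 1) / 2 = k := by omega
  simp [digitCoord, this]

theorem exists_digit (i j : ℕ) : ∃ n, digitCoord n = i ∧ digitGap n = j := by
  cases i with
  | zero => exact ⟨2 * j, digitCoord_even j, digitGap_even j⟩
  | succ i =>
    have : (2 * Nat.pair i j + 1) / 2 = Nat.pair i j := by omega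
    exact ⟨2 * Nat.pair i j + 1, by simp [digitCoord, this], by simp [digitGap, this]⟩

section Straightening

variable (p q : ℕ → ℕ → ℝ)

/-- The `n`th digit of the code of a point, extended continuously to the whole cube. -/
noncomputable def digit (n : ℕ) (x : HilbertCube) : ℝ :=
  ramp (p (digitCoord n) (digitGap n)) (q (digitCoord n) (digitGap n)) (x (digitCoord n))

noncomputable def evenSum (x : HilbertCube) : ℝ := ∑' k, (1/3) ^ (2 * k) * digit p q (2 * k) x

noncomputable def oddSum (x : HilbertCube) : ℝ :=
  ∑' k, (1/3) ^ (2 * k + 1) * digit p q (2 * k + 1) x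

theorem continuous_digit (n : ℕ) : Continuous (digit p q n) :=
  (continuous_ramp _ _).comp (by fun_prop)

theorem hasSum_even_weights : HasSum (fun k : ℕ => (1/3 : ℝ) ^ (2 * k)) (9/8) := by
  have := hasSum_geometric_of_lt_one (r := (1/9 : ℝ)) (by norm_num) (by norm_num)
  convert this using 1
  · ext k; rw [pow_mul]; norm_num
  · norm_num

theorem hasSum_odd_weights : HasSum (fun k : ℕ => (1/3 : ℝ) ^ (2 * k + 1)) (3/8) := by
  simp only [pow_succ]
  have := hasSum_even_weights.mul_right (1/3)
  norm_num at this ⊢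
  exact this

theorem weight_mul_le (w b : ℝ) (hw : 0 ≤ w) (h0 : 0 ≤ b) (h1 : b ≤ 1) : ‖w * b‖ ≤ w := by
  rw [Real.norm_of_nonneg (mul_nonneg hw h0)]
  exact mul_le_of_le_one_right hw h1

theorem norm_weight_digit_le (n : ℕ) (x : HilbertCube) :
    ‖(1/3) ^ n * digit p q n x‖ ≤ (1/3) ^ n :=
  weight_mul_le _ _ (by positivity) (ramp_nonneg _ _ _) (ramp_le_one _ _ _)

theorem summable_even (x : HilbertCube) :
    Summable fun k => (1/3) ^ (2 * k) * digit p q (2 * k) x :=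
  .of_norm_bounded hasSum_even_weights.summable fun _ => norm_weight_digit_le p q _ x

theorem summable_odd (x : HilbertCube) :
    Summable fun k => (1/3) ^ (2 * k + 1) * digit p q (2 * k + 1) x :=
  .of_norm_bounded hasSum_odd_weights.summable fun _ => norm_weight_digit_le p q _ x

theorem continuous_evenSum : Continuous (evenSum p q) :=
  continuous_tsum (fun _ => continuous_const.mul (continuous_digit p q _))
    hasSum_even_weights.summable fun _ x => norm_weight_digit_le p q _ x

theorem continuous_oddSum : Continuous (oddSum p q) :=
  continuous_tsum (fun _ => continuous_const.mul (continuous_digit p q _))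
    hasSum_odd_weights.summable fun _ x => norm_weight_digit_le p q _ x

theorem oddSum_mem (x : HilbertCube) : oddSum p q x ∈ Icc (0:ℝ) (3/8) := by
  refine ⟨tsum_nonneg fun _ => mul_nonneg (by positivity) (ramp_nonneg _ _ _), ?_⟩
  rw [← hasSum_odd_weights.tsum_eq]
  refine (summable_odd p q x).tsum_le_tsum (fun _ => ?_) hasSum_odd_weights.summable
  exact (le_abs_self _).trans (norm_weight_digit_le p q _ x)

theorem oddSum_update (x : HilbertCube) (t : UI) :
    oddSum p q (Function.update x 0 t) = oddSum p q x := by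
  simp [oddSum, digit, digitCoord_odd]

/-- A strictly increasing function of the zeroth coordinate whose values on a product of nowhere
dense sets are determined by the ternary expansion made of all digits. -/
noncomputable def straighten (a b : ℝ) (x : HilbertCube) : ℝ :=
  (1/8 + 1/2 * oddSum p q x) * ramp 0 a (x 0) + 1/2 * evenSum p q x +
    (1/8 + 1/2 * (3/8 - oddSum p q x)) * ramp b 1 (x 0)

variable {p q} {C : ℕ → Set UI}

theorem digit_even_zero (hpq : ∀ i, IsGapSequence (C i) (p i) (q i))
    (x : HilbertCube) (k : ℕ) (hx : x 0 = 0) : digit p q (2 * k) x = 0 := by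
  rw [digit, digitCoord_even]
  refine ramp_of_le ((hpq _).1 _).2.1 ?_
  rw [hx]
  exact ((hpq _).1 _).1

theorem digit_even_one (hpq : ∀ i, IsGapSequence (C i) (p i) (q i))
    (x : HilbertCube) (k : ℕ) (hx : x 0 = 1) : digit p q (2 * k) x = 1 := by
  rw [digit, digitCoord_even]
  refine ramp_of_ge ((hpq _).1 _).2.1 ?_
  rw [hx]
  exact ((hpq _).1 _).2.2

theorem evenSum_strictMono (hpq : ∀ i, IsGapSequence (C i) (p i) (q i))
    (x : HilbertCube) :
    StrictMono fun t : UI => evenSum p q (Function.update x 0 t) := by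
  intro s t hst
  have hle : ∀ k, (1/3) ^ (2 * k) * digit p q (2 * k) (Function.update x 0 s) ≤
      (1/3) ^ (2 * k) * digit p q (2 * k) (Function.update x 0 t) := by
    intro k
    refine mul_le_mul_of_nonneg_left ?_ (by positivity)
    simp only [digit, digitCoord_even, Function.update_self]
    exact ramp_mono ((hpq _).1 _).2.1 hst.le
  obtain ⟨k, hk1, hk2⟩ := (hpq 0).2.2 s t hst
  refine Summable.tsum_lt_tsum (i := k) hle ?_ (summable_even p q _) (summable_even p q _)
  refine mul_lt_mul_of_pos_left ?_ (by positivity)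
  simp only [digit, digitCoord_even, Function.update_self, digitGap_even]
  rw [ramp_of_le ((hpq _).1 _).2.1 hk1, ramp_of_ge ((hpq _).1 _).2.1 hk2]
  exact zero_lt_one

theorem exists_homeomorph_straighten_zero (hpq : ∀ i, IsGapSequence (C i) (p i) (q i))
    {a b : ℝ} (ha : 0 < a) (ha1 : a ≤ 1) (hb : 0 ≤ b)
    (hb1 : b < 1) :
    ∃ H : HilbertCube ≃ₜ HilbertCube, ∀ x, (H x 0 : ℝ) = straighten p q a b x := by
  refine exists_homeomorph_update _ ?_ (fun x s t hst => ?_) (fun x => ?_) fun x => ?_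
  · have h1 := continuous_oddSum p q
    have h2 := continuous_evenSum p q
    have h3 := continuous_ramp 0 a
    have h4 := continuous_ramp b 1
    unfold straighten
    fun_prop
  · have hO := oddSum_mem p q x
    have hst' : (s : ℝ) ≤ t := hst.le
    have h1 := mul_le_mul_of_nonneg_left (ramp_mono ha hst')
      (show 0 ≤ 1/8 + 1/2 * oddSum p q x by linarith [hO.1])
    have h2 := mul_le_mul_of_nonneg_left (ramp_mono hb1 hst')
      (show 0 ≤ 1/8 + 1/2 * (3/8 - oddSum p q x) by linarith [hO.2])
    have h3 := evenSum_strictMono hpq x hst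
    simp only [straighten, oddSum_update, Function.update_self]
    simp only at h3
    linarith
  · have h : evenSum p q (Function.update x 0 0) = 0 := by
      simp [evenSum, digit_even_zero hpq]
    simp [straighten, h, ramp_of_le ha le_rfl, ramp_of_le hb1 hb]
  · have h : evenSum p q (Function.update x 0 1) = 9/8 := by
      simp only [evenSum, digit_even_one hpq _ _ (Function.update_self 0 (1 : UI) x), mul_one]
      exact hasSum_even_weights.tsum_eq
    simp [straighten, h, ramp_of_ge ha ha1, ramp_of_ge hb1 le_rfl]
    ring

theorem digit_eq_cond (hpq : ∀ i, IsGapSequence (C i) (p i) (q i))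
    (n : ℕ) (x : HilbertCube) (hx : ∀ i, x i ∈ C i) :
    digit p q n x =
      if q (digitCoord n) (digitGap n) ≤ x (digitCoord n) then 1 else 0 := by
  have hg := ((hpq (digitCoord n)).1 (digitGap n)).2.1
  split_ifs with h
  · exact ramp_of_ge hg h
  · exact ramp_of_le hg (((hpq _).2.1 _ _ (hx _)).resolve_right h)

theorem straighten_eq (hpq : ∀ i, IsGapSequence (C i) (p i) (q i))
    {a b : ℝ} (ha : 0 < a) (hb1 : b < 1)
    (hab : ∀ x ∈ C 0, a ≤ x ∧ x ≤ b) (x : HilbertCube) (hx : ∀ i, x i ∈ C i) :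
    straighten p q a b x = 1/8 + 1/2 * cantorFunction (1/3)
      fun n => decide (q (digitCoord n) (digitGap n) ≤ x (digitCoord n)) := by
  have hs : evenSum p q x + oddSum p q x = cantorFunction (1/3)
      fun n => decide (q (digitCoord n) (digitGap n) ≤ x (digitCoord n)) := by
    rw [evenSum, oddSum, tsum_even_add_odd (f := fun n => (1/3) ^ n * digit p q n x)
      (summable_even p q x) (summable_odd p q x)]
    refine tsum_congr fun n => ?_
    rw [digit_eq_cond hpq n x hx, cantorFunctionAux]
    split_ifs with h <;> simp [h]
  rw [← hs, straighten, ramp_of_ge ha (hab _ (hx 0)).1, ramp_of_le hb1 (hab _ (hx 0)).2]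
  ring

end Straightening

theorem exists_minimal_of_pi (C : ℕ → Set UI) (hC : ∀ i, IsClosed (C i))
    (hi : ∀ i, interior (C i) = ∅) (h0 : ∀ x ∈ C 0, (x : ℝ) ∈ Ioo (0:ℝ) 1) :
    ∃ M, IsMinimalCantorSet M ∧ {x : HilbertCube | ∀ i, x i ∈ C i} ⊆ M := by
  choose p q hpq using fun i => exists_gapSequence (C i) (hC i) (hi i)
  obtain ⟨a, b, ha, ha1, hb, hb1, hab⟩ := exists_pos_bounds (C 0) (hC 0) h0
  let A : Set HilbertCube := {x | ∀ i, x i ∈ C i}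
  have hA : IsClosed A := by
    have : A = ⋂ i, (fun x : HilbertCube => x i) ⁻¹' C i := by ext; simp [A]
    rw [this]
    exact isClosed_iInter fun i => (hC i).preimage (continuous_apply i)
  let β : A → ℕ → Bool := fun x n =>
    decide (q (digitCoord n) (digitGap n) ≤ x.1 (digitCoord n))
  have hβ : Continuous β := by
    refine continuous_pi fun n => (continuous_bool_rng true).2 ⟨?_, ?_⟩
    · have : (fun x => β x n) ⁻¹' {true} =
          {x : A | q (digitCoord n) (digitGap n) ≤ x.1 (digitCoord n)} := by
        ext x; simp [β]
      rw [this]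
      exact isClosed_le continuous_const (continuous_subtype_val.comp
        ((continuous_apply _).comp continuous_subtype_val))
    · have : (fun x => β x n) ⁻¹' {true} =
          {x : A | p (digitCoord n) (digitGap n) < x.1 (digitCoord n)} := by
        ext x
        have h1 := ((hpq (digitCoord n)).1 (digitGap n)).2.1
        have h2 := (hpq (digitCoord n)).2.1 (digitGap n) _ (x.2 (digitCoord n))
        simp only [β, mem_preimage, mem_singleton_iff, decide_eq_true_eq]
        exact ⟨fun h => h1.trans_le h, fun h => h2.resolve_left (not_le.2 h)⟩
      rw [this]
      exact isOpen_lt continuous_const (continuous_subtype_val.comp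
        ((continuous_apply _).comp continuous_subtype_val))
  have hβi : Function.Injective β := by
    have key : ∀ (x y : A) i, x.1 i < y.1 i → β x ≠ β y := by
      intro x y i hxy he
      obtain ⟨k, hk1, hk2⟩ := (hpq i).2.2 _ _ hxy
      obtain ⟨n, rfl, rfl⟩ := exists_digit i k
      have h1 : β y n = true := decide_eq_true hk2
      have h2 : β x n = false :=
        decide_eq_false (not_le.2 (hk1.trans_lt ((hpq _).1 _).2.1))
      rw [he, h1] at h2
      exact absurd h2 (by decide)
    intro x y h
    apply Subtype.ext
    funext i
    rcases lt_trichotomy (x.1 i) (y.1 i) with hlt | heq | hgt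
    · exact absurd h (key x y i hlt)
    · exact heq
    · exact absurd h.symm (key y x i hgt)
  have : CompactSpace A := isCompact_iff_compactSpace.1 hA.isCompact
  have : TotallyDisconnectedSpace A :=
    ⟨isTotallyDisconnected_of_image hβ.continuousOn hβi
      (isTotallyDisconnected_of_totallyDisconnectedSpace _)⟩
  obtain ⟨G, hG⟩ := exists_homeomorph_straighten_zero hpq ha ha1 hb hb1
  obtain ⟨H, hH⟩ := exists_homeomorph_cube (C := A) (fun x => G x.1) (fun x => stdCantor (β x))
    (by fun_prop) (continuous_stdCantor.comp hβ) (fun x y h => hβi (by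
      have h1 : (G x.1 0 : ℝ) = G y.1 0 := congrArg Subtype.val h
      rw [hG, hG, straighten_eq hpq ha hb1 hab _ x.2, straighten_eq hpq ha hb1 hab _ y.2] at h1
      exact cantorFunction_injective (c := 1/3) (by norm_num) (by norm_num) (by linarith)))
    (stdCantor_injective_zero.comp hβi)
  refine ⟨_, isMinimalCantorSet_range_stdCantor.preimage (G.trans H), fun x hx => ?_⟩
  exact ⟨β ⟨x, hx⟩, (hH ⟨x, hx⟩).symm⟩

/-- The real number in `(0,1]` whose binary expansion has blocks of zeros of lengths `u 0`, `u 1`,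
`u 2`, ..., each of them followed by a single one. -/
noncomputable def runReal (u : ℕ → ℕ) : ℝ :=
  ∑' n, (1/2) ^ (∑ m ∈ Finset.range (n + 1), (u m + 1))

theorem runReal_term_le (u : ℕ → ℕ) (n : ℕ) :
    ((1/2 : ℝ)) ^ (∑ m ∈ Finset.range (n + 1), (u m + 1)) ≤ 1 / 2 / 2 ^ n := by
  have h : n + 1 ≤ ∑ m ∈ Finset.range (n + 1), (u m + 1) := by
    rw [Finset.sum_add_distrib]
    simp
  calc _ ≤ ((1/2 : ℝ)) ^ (n + 1) := pow_le_pow_of_le_one (by norm_num) (by norm_num) h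
    _ = _ := by rw [pow_succ, one_div_pow]; ring

theorem summable_runReal (u : ℕ → ℕ) :
    Summable fun n => ((1/2 : ℝ)) ^ (∑ m ∈ Finset.range (n + 1), (u m + 1)) :=
  .of_nonneg_of_le (fun _ => by positivity) (runReal_term_le u) (summable_geometric_two' 1)

theorem runReal_mem (u : ℕ → ℕ) : runReal u ∈ Ioc (0:ℝ) 1 := by
  refine ⟨(summable_runReal u).tsum_pos (fun _ => by positivity) 0 (by positivity), ?_⟩
  rw [← tsum_geometric_two' 1]
  exact (summable_runReal u).tsum_le_tsum (runReal_term_le u) (summable_geometric_two' 1)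

theorem continuous_runReal : Continuous runReal := by
  refine continuous_tsum (fun n => ?_) (summable_geometric_two' 1) fun n u => ?_
  · exact (continuous_of_discreteTopology (f := fun k : ℕ => ((1/2 : ℝ)) ^ k)).comp
      (continuous_finsetSum _ fun m _ => by fun_prop)
  · rw [Real.norm_of_nonneg (by positivity)]
    exact runReal_term_le u n

theorem runReal_eq (u : ℕ → ℕ) :
    runReal u = (1/2) ^ (u 0 + 1) * (1 + runReal fun n => u (n + 1)) := by
  rw [runReal, (summable_runReal u).tsum_eq_zero_add, mul_add, runReal, ← tsum_mul_left]
  congr 1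
  · simp
  · refine tsum_congr fun n => ?_
    rw [Finset.sum_range_succ' _ (n + 1), pow_add, mul_comm]

theorem runReal_mem_zero (u : ℕ → ℕ) : runReal u ∈ Ioc ((1/2 : ℝ) ^ (u 0 + 1)) ((1/2) ^ u 0) := by
  have h := runReal_mem fun n => u (n + 1)
  have hp : (0:ℝ) < (1/2) ^ (u 0 + 1) := by positivity
  rw [runReal_eq]
  constructor
  · nlinarith [h.1]
  · rw [pow_succ] at hp ⊢
    nlinarith [h.2]

theorem eq_of_mem_dyadic {x : ℝ} {m n : ℕ} (hm : x ∈ Ioc ((1/2 : ℝ) ^ (m + 1)) ((1/2) ^ m))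
    (hn : x ∈ Ioc ((1/2 : ℝ) ^ (n + 1)) ((1/2) ^ n)) : m = n := by
  have key : ∀ {a b : ℕ}, x ∈ Ioc ((1/2 : ℝ) ^ (a + 1)) ((1/2) ^ a) →
      x ∈ Ioc ((1/2 : ℝ) ^ (b + 1)) ((1/2) ^ b) → ¬ a < b := fun {a b} ha hb hab =>
    absurd (ha.1.trans_le hb.2)
      (not_lt.2 (pow_le_pow_of_le_one (by norm_num) (by norm_num) hab))
  exact le_antisymm (not_lt.1 (key hn hm)) (not_lt.1 (key hm hn))

theorem runReal_injective : Function.Injective runReal := by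
  have key : ∀ n, ∀ u v, runReal u = runReal v → u n = v n := by
    intro n
    induction n with
    | zero => exact fun u v h => eq_of_mem_dyadic (runReal_mem_zero u) (h ▸ runReal_mem_zero v)
    | succ n ih =>
      intro u v h
      have h0 : u 0 = v 0 := eq_of_mem_dyadic (runReal_mem_zero u) (h ▸ runReal_mem_zero v)
      refine ih (fun n => u (n + 1)) (fun n => v (n + 1)) ?_
      rw [runReal_eq u, runReal_eq v, h0] at h
      have := mul_left_cancel₀ (by positivity) h
      linarith
  exact fun u v h => funext fun n => key n u v h

theorem exists_runReal_eq {x : ℝ} (hx : x ∈ Ioc (0:ℝ) 1) : ∃ u, runReal u = x := by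
  have hE : ∀ x : Ioc (0:ℝ) 1, ∃ n : ℕ, ∃ y : Ioc (0:ℝ) 1,
      (x : ℝ) = (1/2) ^ (n + 1) * (1 + y) := by
    intro x
    obtain ⟨n, h1, h2⟩ := exists_nat_pow_near_of_lt_one x.2.1 x.2.2 (y := (1/2 : ℝ)) (by norm_num)
      (by norm_num)
    have hp : (0:ℝ) < (1/2) ^ (n + 1) := by positivity
    refine ⟨n, ⟨x / (1/2) ^ (n + 1) - 1, ?_, ?_⟩, ?_⟩
    · rw [sub_pos, one_lt_div hp]
      exact h1
    · rw [sub_le_iff_le_add, div_le_iff₀ hp, pow_succ]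
      linarith
    · simp only
      field_simp
      ring
  choose d T hT using hE
  have key : ∀ N : ℕ, ∀ x : Ioc (0:ℝ) 1,
      |runReal (fun k => d (T^[k] x)) - x| ≤ (1/2) ^ N := by
    intro N
    induction N with
    | zero =>
      intro x
      have h := runReal_mem fun k => d (T^[k] x)
      rw [abs_le]
      constructor <;> norm_num <;> linarith [h.1, h.2, x.2.1, x.2.2]
    | succ N ih =>
      intro x
      have h1 : runReal (fun k => d (T^[k] x)) - x =
          (1/2) ^ (d x + 1) * (runReal (fun k => d (T^[k] (T x))) - T x) := by
        rw [runReal_eq]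
        simp only [Function.iterate_zero, id, Function.iterate_succ_apply]
        linear_combination -hT x
      rw [h1, abs_mul, abs_of_nonneg (by positivity), pow_succ' _ N]
      refine mul_le_mul ?_ (ih (T x)) (abs_nonneg _) (by norm_num)
      exact pow_le_of_le_one (by norm_num) (by norm_num) (by omega)
  refine ⟨fun k => d (T^[k] ⟨x, hx⟩), ?_⟩
  have hl := ge_of_tendsto' (tendsto_pow_atTop_nhds_zero_of_lt_one (r := (1/2 : ℝ)) (by norm_num)
    (by norm_num)) fun N => key N ⟨x, hx⟩
  exact sub_eq_zero.1 (abs_eq_zero.1 (le_antisymm hl (abs_nonneg _)))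

/-- The basic open set of sequences which agree with `y` on the first `n` places. -/
def initSeg (y : ℕ → ℕ) (n : ℕ) : Set (ℕ → ℕ) := {z | ∀ m < n, z m = y m}

theorem exists_initSeg_subset {O : Set (ℕ → ℕ)} (hO : IsOpen O) {y : ℕ → ℕ} (hy : y ∈ O) :
    ∃ n, initSeg y n ⊆ O := by
  obtain ⟨I, u, hu, hsub⟩ := isOpen_pi_iff.1 hO y hy
  refine ⟨I.sup id + 1, fun z hz => hsub fun i hi => ?_⟩
  rw [hz i (Nat.lt_succ_of_le (Finset.le_sup (f := id) hi))]
  exact (hu i hi).2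

theorem exists_Ioo_subset_image_initSeg (n : ℕ) (y : ℕ → ℕ) :
    ∃ a b, 0 ≤ a ∧ a < b ∧ b ≤ 1 ∧ Ioo a b ⊆ runReal '' initSeg y n := by
  induction n generalizing y with
  | zero =>
    refine ⟨0, 1, le_rfl, one_pos, le_rfl, fun x hx => ?_⟩
    obtain ⟨u, hu⟩ := exists_runReal_eq (Ioo_subset_Ioc_self hx)
    exact ⟨u, by simp [initSeg], hu⟩
  | succ n ih =>
    obtain ⟨a, b, ha, hab, hb, hs⟩ := ih fun m => y (m + 1)
    have hp : (0:ℝ) < (1/2) ^ (y 0 + 1) := by positivity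
    have hp2 : (1/2 : ℝ) ^ (y 0 + 1) ≤ 1/2 :=
      pow_le_of_le_one (by norm_num) (by norm_num) (by omega)
    refine ⟨(1/2) ^ (y 0 + 1) * (1 + a), (1/2) ^ (y 0 + 1) * (1 + b), by positivity,
      by nlinarith, by nlinarith, fun x hx => ?_⟩
    obtain ⟨u, hu, hux⟩ := hs (show x / (1/2) ^ (y 0 + 1) - 1 ∈ Ioo a b by
      constructor
      · rw [lt_sub_iff_add_lt, lt_div_iff₀ hp]; linarith [hx.1]
      · rw [sub_lt_iff_lt_add, div_lt_iff₀ hp]; linarith [hx.2])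
    refine ⟨fun k => Nat.casesOn k (y 0) u, fun m hm => ?_, ?_⟩
    · cases m with
      | zero => rfl
      | succ m => exact hu m (by omega)
    · rw [runReal_eq]
      change (1/2) ^ (y 0 + 1) * (1 + runReal u) = x
      rw [hux, add_sub_cancel, mul_div_cancel₀ _ hp.ne']

/-- The scale of the `i`th coordinate of the image of `baireToCube`; it keeps the zeroth coordinate
away from the endpoint `1`. -/
noncomputable def rowScale (i : ℕ) : ℝ := if i = 0 then 1/2 else 1

theorem rowScale_mem (i : ℕ) : rowScale i ∈ Ioc (0:ℝ) 1 := by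
  unfold rowScale
  split_ifs <;> norm_num

/-- A coordinate of `baireToCube` as a function of a row of the argument. -/
noncomputable def rowCoord (i : ℕ) (u : ℕ → ℕ) : UI :=
  ⟨rowScale i * runReal u, mul_nonneg (rowScale_mem i).1.le (runReal_mem u).1.le,
    mul_le_one₀ (rowScale_mem i).2 (runReal_mem u).1.le (runReal_mem u).2⟩

theorem continuous_rowCoord (i : ℕ) : Continuous (rowCoord i) :=
  (continuous_const.mul continuous_runReal).subtype_mk _

theorem rowCoord_injective (i : ℕ) : Function.Injective (rowCoord i) := fun _ _ h =>
  runReal_injective (mul_left_cancel₀ (rowScale_mem i).1.ne' (congrArg Subtype.val h))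

theorem exists_open_subset_image_initSeg (i n : ℕ) (y : ℕ → ℕ) :
    ∃ O : Set UI, IsOpen O ∧ O.Nonempty ∧ O ⊆ rowCoord i '' initSeg y n := by
  obtain ⟨a, b, ha, hab, hb, hs⟩ := exists_Ioo_subset_image_initSeg n y
  have hr := rowScale_mem i
  refine ⟨{t | (t : ℝ) / rowScale i ∈ Ioo a b}, isOpen_Ioo.preimage (by fun_prop), ?_, ?_⟩
  · refine ⟨⟨rowScale i * ((a + b) / 2), mul_nonneg hr.1.le (by linarith),
      mul_le_one₀ hr.2 (by linarith) (by linarith)⟩, ?_⟩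
    simp only [mem_ofPred_eq, mul_div_cancel_left₀ _ hr.1.ne']
    constructor <;> linarith
  · intro t ht
    obtain ⟨u, hu, hut⟩ := hs ht
    refine ⟨u, hu, Subtype.ext ?_⟩
    simp only [rowCoord, hut]
    exact mul_div_cancel₀ _ hr.1.ne'

theorem interior_closure_image_rowCoord (i : ℕ) (E : Set (ℕ → ℕ)) (hE : IsClosed E)
    (hi : interior E = ∅) : interior (closure (rowCoord i '' E)) = ∅ := by
  by_contra hne
  obtain ⟨t, ht⟩ := nonempty_iff_ne_empty.2 hne
  obtain ⟨-, hy, y, hyE, rfl⟩ := mem_closure_iff.1 (interior_subset ht) _ isOpen_interior ht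
  have hO := isOpen_interior.preimage (continuous_rowCoord i)
    (t := interior (closure (rowCoord i '' E)))
  obtain ⟨z, hz, hzE⟩ : (rowCoord i ⁻¹' interior (closure (rowCoord i '' E)) \ E).Nonempty := by
    by_contra hcon
    rw [not_nonempty_iff_eq_empty, sdiff_eq_empty] at hcon
    have : y ∈ interior E := mem_interior.2 ⟨_, hcon, hO, hy⟩
    rw [hi] at this
    exact this
  obtain ⟨n, hn⟩ := exists_initSeg_subset (hO.inter hE.isOpen_compl) ⟨hz, hzE⟩
  obtain ⟨O, hOo, ⟨s, hs⟩, hsub⟩ := exists_open_subset_image_initSeg i n z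
  obtain ⟨v, hv, rfl⟩ := hsub hs
  obtain ⟨-, hu, u, huE, rfl⟩ := mem_closure_iff.1 (interior_subset (hn hv).1) O hOo hs
  obtain ⟨v', hv', he⟩ := hsub hu
  exact (hn hv').2 (rowCoord_injective i he ▸ huE)

theorem isClosed_pi_discrete (S : ℕ → Set ℕ) : IsClosed {u : ℕ → ℕ | ∀ n, u n ∈ S n} := by
  simp only [Set.ofPred_forall]
  exact isClosed_iInter fun n => (isClosed_discrete (S n)).preimage (continuous_apply n)

theorem interior_pi_discrete (S : ℕ → Set ℕ) (hS : ∀ N, ∃ n ≥ N, S n ≠ Set.univ) :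
    interior {u : ℕ → ℕ | ∀ n, u n ∈ S n} = ∅ := by
  by_contra hne
  obtain ⟨y, hy⟩ := nonempty_iff_ne_empty.2 hne
  obtain ⟨N, hN⟩ := exists_initSeg_subset isOpen_interior hy
  obtain ⟨n, hn, hSn⟩ := hS N
  obtain ⟨a, ha⟩ := (ne_univ_iff_exists_notMem _).1 hSn
  have h1 : Function.update y n a ∈ initSeg y N := fun m hm =>
    Function.update_of_ne (by omega) _ _
  have h2 := interior_subset (hN h1) n
  rw [Function.update_self] at h2
  exact ha h2

/-- A continuous map of the Baire space onto a dense subset of an open subset of the Hilbert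
cube. -/
noncomputable def baireToCube (y : ℕ → ℕ) : HilbertCube :=
  fun i => rowCoord i fun n => y (Nat.pair i n)

theorem continuous_baireToCube : Continuous baireToCube :=
  continuous_pi fun i => (continuous_rowCoord i).comp (by fun_prop)

theorem exists_minimal_of_baire (S : ℕ → Set ℕ) (hS : ∀ᶠ n in Filter.atTop, S n ≠ Set.univ)
    (h0 : BddAbove (S 0)) :
    ∃ M, IsMinimalCantorSet M ∧ baireToCube '' {y | ∀ n, y n ∈ S n} ⊆ M := by
  obtain ⟨N, hN⟩ := Filter.eventually_atTop.1 hS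
  obtain ⟨b, hb⟩ := h0
  obtain ⟨M, hM, hsub⟩ := exists_minimal_of_pi
    (fun i => closure (rowCoord i '' {u | ∀ n, u n ∈ S (Nat.pair i n)})) (fun i => isClosed_closure)
    (fun i => interior_closure_image_rowCoord i _ (isClosed_pi_discrete _)
      (interior_pi_discrete _ fun m => ⟨max m N, le_max_left _ _,
        hN _ ((le_max_right _ _).trans (Nat.right_le_pair _ _))⟩)) (fun x hx => by
      have hc : IsClosed {t : UI | (t : ℝ) ∈ Icc (1/2 * (1/2) ^ (b + 1)) (1/2 : ℝ)} :=
        isClosed_Icc.preimage continuous_subtype_val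
      have hx' := (hc.closure_subset_iff (s := rowCoord 0 '' {u | ∀ n, u n ∈ S (Nat.pair 0 n)})).2
        (by
          rintro _ ⟨u, hu, rfl⟩
          have h1 := runReal_mem_zero u
          have h2 := runReal_mem u
          have h3 : ((1/2 : ℝ)) ^ (b + 1) ≤ (1/2) ^ (u 0 + 1) :=
            pow_le_pow_of_le_one (by norm_num) (by norm_num) (Nat.succ_le_succ (hb (hu 0)))
          simp only [rowCoord, rowScale, mem_ofPred_eq, if_true]
          constructor <;> linarith [h1.1, h2.2]) hx
      have hp : (0:ℝ) < 1/2 * (1/2) ^ (b + 1) := by positivity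
      exact ⟨hp.trans_le hx'.1, hx'.2.trans_lt (by norm_num)⟩)
  refine ⟨M, hM, ?_⟩
  rintro _ ⟨y, hy, rfl⟩
  exact hsub fun i => subset_closure ⟨_, fun n => hy _, rfl⟩

theorem interior_preimage_baireToCube (N : Set HilbertCube) (hN : IsClosed N)
    (hi : interior N = ∅) : interior (baireToCube ⁻¹' N) = ∅ := by
  by_contra hne
  obtain ⟨y, hy⟩ := nonempty_iff_ne_empty.2 hne
  obtain ⟨n, hn⟩ := exists_initSeg_subset isOpen_interior hy
  choose O hO hOne hsub using fun i => exists_open_subset_image_initSeg i n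
    fun m => y (Nat.pair i m)
  let W : Set HilbertCube := (Set.Iic n).pi O
  have hW : IsOpen W := isOpen_set_pi (finite_Iic n) fun i _ => hO i
  obtain ⟨x, hx⟩ : W.Nonempty := ⟨fun i => (hOne i).some, fun i _ => (hOne i).some_mem⟩
  have hpos : ∀ x ∈ W, (∀ i, n < i → 0 < (x i : ℝ)) → x ∈ N := by
    intro x hx hx0
    have hu : ∀ i, ∃ u, (i ≤ n → u ∈ initSeg (fun m => y (Nat.pair i m)) n) ∧
        rowCoord i u = x i := by
      intro i
      rcases le_or_gt i n with h | h
      · obtain ⟨u, hu, hux⟩ := hsub i (hx i h)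
        exact ⟨u, fun _ => hu, hux⟩
      · obtain ⟨u, hu⟩ := exists_runReal_eq ⟨hx0 i h, (x i).2.2⟩
        refine ⟨u, fun h' => absurd h' (not_le.2 h), Subtype.ext ?_⟩
        simp [rowCoord, rowScale, hu, (Nat.zero_lt_of_lt h).ne']
    choose u hu hux using hu
    have hz : (fun k => u k.unpair.1 k.unpair.2) ∈ initSeg y n := by
      intro m hm
      have h1 := hu m.unpair.1 ((Nat.unpair_left_le m).trans hm.le) m.unpair.2
        ((Nat.unpair_right_le m).trans_lt hm)
      simpa only [Nat.pair_unpair] using h1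
    have h2 := interior_subset (hn hz)
    have h3 : baireToCube (fun k => u k.unpair.1 k.unpair.2) = x := by
      funext i
      simp [baireToCube, hux]
    exact h3 ▸ h2
  have hWN : W ⊆ N := by
    intro x hx
    let a : ℕ → UI := fun k => ⟨1 / (k + 1), by positivity, by
      rw [div_le_one (by positivity)]
      simp⟩
    have ha : Filter.Tendsto a Filter.atTop (𝓝 0) :=
      tendsto_subtype_rng.2 tendsto_one_div_add_atTop_nhds_zero_nat
    have hl : Filter.Tendsto (fun (k : ℕ) i => if i ≤ n then x i else max (x i) (a k))
        Filter.atTop (𝓝 x) := by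
      rw [tendsto_pi_nhds]
      intro i
      split_ifs
      · exact tendsto_const_nhds
      · have := (tendsto_const_nhds (x := x i)).max ha
        rwa [max_eq_left (show 0 ≤ x i from (x i).2.1)] at this
    refine hN.mem_of_tendsto hl (Filter.Eventually.of_forall fun k => hpos _ ?_ ?_)
    · intro i hin
      simp only [if_pos (mem_Iic.1 hin)]
      exact hx i hin
    · intro i hin
      simp only [if_neg (not_le.2 hin)]
      have h1 : (0:ℝ) < a k := by simp only [a]; positivity
      exact h1.trans_le (le_max_right (x i) (a k) : a k ≤ _)
  have : x ∈ interior N := mem_interior.2 ⟨W, hWN, hW, hx⟩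
  rw [hi] at this
  exact this

theorem exists_monotone_cover {X : Type*} [TopologicalSpace X] {Y : Set X} (hY : IsMeagre Y) :
    ∃ N : ℕ → Set X, Monotone N ∧ (∀ n, IsClosed (N n) ∧ interior (N n) = ∅) ∧ Y ⊆ ⋃ n, N n := by
  obtain ⟨S, hS, hc, hsub⟩ := isMeagre_iff_countable_union_isNowhereDense.1 hY
  obtain ⟨f, hf⟩ := (hc.insert ∅).exists_eq_range (insert_nonempty _ _)
  have hfn : ∀ n, IsNowhereDense (f n) := by
    intro n
    have : f n ∈ insert ∅ S := hf ▸ mem_range_self n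
    rcases this with h | h
    · rw [h]; exact isNowhereDense_empty
    · exact hS _ h
  refine ⟨fun n => ⋃ m ∈ Set.Iic n, closure (f m), fun a b hab =>
    biUnion_subset_biUnion_left (Iic_subset_Iic.2 hab), fun n => ⟨?_, ?_⟩, ?_⟩
  · exact (finite_Iic n).isClosed_biUnion fun _ _ => isClosed_closure
  · induction n with
    | zero => simpa [Iic, IsNowhereDense] using hfn 0
    | succ n ih =>
      have : (⋃ m ∈ Set.Iic (n + 1), closure (f m)) =
          closure (f (n + 1)) ∪ ⋃ m ∈ Set.Iic n, closure (f m) :=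
        (Set.biUnion_le_succ (fun m => closure (f m)) n).trans (union_comm _ _)
      simp only at ih ⊢
      rw [this, interior_union_isClosed_of_interior_empty isClosed_closure ih]
      exact hfn _
  · refine hsub.trans (sUnion_subset fun s hs => ?_)
    have : s ∈ range f := hf ▸ mem_insert_of_mem _ hs
    obtain ⟨n, rfl⟩ := this
    exact subset_closure.trans ((subset_biUnion_of_mem (u := fun m => closure (f m))
      (mem_Iic.2 le_rfl)).trans (subset_iUnion (fun n => ⋃ m ∈ Set.Iic n, closure (f m)) n))

theorem mem_sigmaC0_of_mem {M X : Set HilbertCube} (hM : IsMinimalCantorSet M) (h : X ⊆ M) :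
    X ∈ sigmaC0 :=
  ⟨fun _ => M, fun _ => hM, h.trans (subset_iUnion (fun _ : ℕ => M) 0)⟩

theorem exists_nat_cover {Y : Set HilbertCube} (hY : IsMeagre Y) :
    ∃ E : ℕ → Set (ℕ → ℕ), Monotone E ∧ (∀ n, IsClosed (E n) ∧ interior (E n) = ∅) ∧
      baireToCube ⁻¹' Y ⊆ ⋃ n, E n := by
  obtain ⟨N, hNm, hN, hYN⟩ := exists_monotone_cover hY
  refine ⟨fun n => baireToCube ⁻¹' N n, fun a b hab => preimage_mono (hNm hab), fun n =>
    ⟨(hN n).1.preimage continuous_baireToCube, interior_preimage_baireToCube _ (hN n).1 (hN n).2⟩,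
    ?_⟩
  rw [← preimage_iUnion]
  exact preimage_mono hYN

/-- The sequence guessed by a meager set. -/
theorem exists_guess (Y : Set HilbertCube) :
    ∃ w : ℕ → ℕ, IsMeagre Y → baireToCube w ∉ Y := by
  by_cases hY : IsMeagre Y
  · obtain ⟨E, -, hE, hsub⟩ := exists_nat_cover hY
    have hd : Dense (⋂ n, (E n)ᶜ) := dense_iInter_of_isOpen_nat
      (fun n => (hE n).1.isOpen_compl) fun n => interior_eq_empty_iff_dense_compl.1 (hE n).2
    obtain ⟨w, hw⟩ := hd.nonempty
    refine ⟨w, fun _ hwY => ?_⟩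
    obtain ⟨n, hn⟩ := mem_iUnion.1 (hsub hwY)
    exact mem_iInter.1 hw n hn
  · exact ⟨0, fun h => absurd h hY⟩

theorem exists_infinitely_equal_functions :
    ∃ w : Set HilbertCube → ℕ → ℕ, ∀ g : ℕ → ℕ, ∃ X ∈ sigmaC0, ∀ Y, IsMeagre Y → X ⊆ Y →
      ∃ᶠ n in Filter.atTop, w Y n = g n := by
  choose w hw using exists_guess
  refine ⟨w, fun g => ?_⟩
  let S : ℕ → ℕ → Set ℕ := fun m n => {a | (m ≤ n → a ≠ g n) ∧ (n = 0 → a ≤ m)}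
  choose M hM hsub using fun m => exists_minimal_of_baire (S m)
    (Filter.eventually_atTop.2 ⟨m, fun n hn h => by
      have : g n ∈ S m n := h ▸ mem_univ _
      exact this.1 hn rfl⟩) ⟨m, fun a ha => ha.2 rfl⟩
  refine ⟨⋃ m, M m, ⟨M, hM, le_rfl⟩, fun Y hY hXY hcon => hw Y hY (hXY ?_)⟩
  obtain ⟨N, hN⟩ := Filter.eventually_atTop.1 hcon
  refine mem_iUnion.2 ⟨max N (w Y 0), hsub _ ⟨w Y, fun n => ⟨fun h => ?_, fun h => ?_⟩, rfl⟩⟩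
  · exact hN n ((le_max_left _ _).trans h)
  · rw [h]
    exact le_max_right _ _

theorem exists_avoiding_extension (E : Set (ℕ → ℕ)) (hE : IsClosed E) (hi : interior E = ∅)
    (s : ℕ → ℕ) (j : ℕ) :
    ∃ (t : ℕ → ℕ) (b : ℕ), (∀ i < j, t i = s i) ∧ initSeg t b ∩ E = ∅ := by
  have ho : IsOpen (initSeg s j) := by
    simp only [initSeg, Set.ofPred_forall]
    exact (finite_Iio j).isOpen_biInter fun m _ =>
      (isOpen_discrete ({s m} : Set ℕ)).preimage (continuous_apply (A := fun _ => ℕ) m)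
  obtain ⟨t, ht, htE⟩ : (initSeg s j \ E).Nonempty := by
    by_contra hcon
    rw [not_nonempty_iff_eq_empty, sdiff_eq_empty] at hcon
    have : s ∈ interior E := mem_interior.2 ⟨_, hcon, ho, fun _ _ => rfl⟩
    rw [hi] at this
    exact this
  obtain ⟨b, hb⟩ := exists_initSeg_subset hE.isOpen_compl htE
  exact ⟨t, b, ht, by rwa [← disjoint_iff_inter_eq_empty, ← subset_compl_iff_disjoint_right]⟩

theorem exists_uniform_bound (E : Set (ℕ → ℕ)) (hE : IsClosed E) (hi : interior E = ∅) (j : ℕ) :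
    ∃ b, ∀ s : ℕ → ℕ, (∀ i < j, s i ≤ j) → ∃ t : ℕ → ℕ, (∀ i < j, t i = s i) ∧ (∀ i, t i ≤ b) ∧
      (∀ i ≥ b, t i = 0) ∧ initSeg t b ∩ E = ∅ := by
  have h1 : ∀ s : Fin j → Fin (j + 1), ∃ b, ∀ c ≥ b, ∃ t : ℕ → ℕ,
      (∀ i : Fin j, t i = s i) ∧ (∀ i, t i ≤ c) ∧ (∀ i ≥ c, t i = 0) ∧ initSeg t c ∩ E = ∅ := by
    intro s
    obtain ⟨t, b, ht, hb⟩ := exists_avoiding_extension E hE hi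
      (fun i => if h : i < j then s ⟨i, h⟩ else 0) j
    refine ⟨max (max b j) ((Finset.range (max b j)).sup t), fun c hc => ?_⟩
    have hcb : max b j ≤ c := (le_max_left _ _).trans hc
    refine ⟨fun i => if i < max b j then t i else 0, fun i => ?_, fun i => ?_, fun i hic => ?_, ?_⟩
    · have := ht i i.2
      simp only [dif_pos i.2] at this
      simp only [if_pos (i.2.trans_le (le_max_right b j)), this]
    · simp only
      split_ifs with h
      · exact (Finset.le_sup (f := t) (Finset.mem_range.2 h)).trans ((le_max_right _ _).trans hc)
      · exact Nat.zero_le _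
    · exact if_neg (not_lt.2 (hcb.trans hic))
    · rw [← subset_empty_iff, ← hb]
      refine inter_subset_inter_left _ fun z hz m hm => ?_
      have hm' : m < max b j := hm.trans_le (le_max_left _ _)
      exact (hz m (hm'.trans_le hcb)).trans (if_pos hm')
  choose b hb using h1
  refine ⟨Finset.univ.sup b, fun s hs => ?_⟩
  obtain ⟨t, ht, h⟩ := hb (fun i => ⟨s i, Nat.lt_succ_of_le (hs i i.2)⟩) _
    (Finset.le_sup (Finset.mem_univ _))
  exact ⟨t, fun i hi => ht ⟨i, hi⟩, h⟩

theorem exists_le_notMem (E : ℕ → Set (ℕ → ℕ)) (hm : Monotone E) (ψ f : ℕ → ℕ) (hf : Monotone f)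
    (hψ : ∀ j, ∀ s : ℕ → ℕ, (∀ i < j, s i ≤ j) → ∃ t : ℕ → ℕ, (∀ i < j, t i = s i) ∧
      (∀ i, t i ≤ ψ j) ∧ (∀ i ≥ ψ j, t i = 0) ∧ initSeg t (ψ j) ∩ E j = ∅)
    (hfr : ∃ᶠ j in Filter.atTop, ψ j ≤ f j) : ∃ y : ℕ → ℕ, (∀ n, y n ≤ f n) ∧ y ∉ ⋃ n, E n := by
  let State : Type := {p : (ℕ → ℕ) × ℕ // (∀ i, p.1 i ≤ p.2) ∧ ∀ i, p.1 i ≤ f i}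
  have step : ∀ (k : ℕ) (p : State), ∃ p' : State, (∀ i < p.1.2, p'.1.1 i = p.1.1 i) ∧
      p.1.2 < p'.1.2 ∧ initSeg p'.1.1 p'.1.2 ∩ E k = ∅ := by
    rintro k ⟨⟨t, b⟩, htb, htf⟩
    obtain ⟨j, hj, hjf⟩ := Filter.frequently_atTop.1 hfr (max b k)
    obtain ⟨t', h1, h2, h3, h4⟩ := hψ j t fun i _ => (htb i).trans ((le_max_left _ _).trans hj)
    refine ⟨⟨(t', max (ψ j) (j + 1)), fun i => (h2 i).trans (le_max_left _ _), fun i => ?_⟩,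
      fun i hi => h1 i (hi.trans_le ((le_max_left _ _).trans hj)), ?_, ?_⟩
    · rcases lt_or_ge i j with h | h
      · exact (h1 i h).trans_le (htf i)
      · exact (h2 i).trans (hjf.trans (hf h))
    · exact lt_max_of_lt_right (Nat.lt_succ_of_le ((le_max_left _ _).trans hj))
    · rw [← subset_empty_iff, ← h4]
      exact inter_subset_inter (fun z hz m hm => hz m (hm.trans_le (le_max_left _ _)))
        (hm ((le_max_right _ _).trans hj))
  choose next hn1 hn2 hn3 using step
  let P : ℕ → State := fun k => Nat.rec ⟨(0, 0), fun _ => le_rfl, fun _ => Nat.zero_le _⟩ next k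
  have hP : ∀ k, P (k + 1) = next k (P k) := fun k => rfl
  have hb : StrictMono fun k => (P k).1.2 := strictMono_nat_of_lt_succ fun k => hn2 k (P k)
  have hag : ∀ k d, ∀ i < (P k).1.2, (P (k + d)).1.1 i = (P k).1.1 i := by
    intro k d i hi
    induction d with
    | zero => rfl
    | succ d ih =>
      rw [← ih, ← add_assoc, hP]
      exact hn1 _ _ i (hi.trans_le (hb.monotone (Nat.le_add_right k d)))
  have hlim : ∀ k, ∀ i < (P k).1.2, (P (i + 1)).1.1 i = (P k).1.1 i := by
    intro k i hi
    rcases le_total k (i + 1) with h | h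
    · obtain ⟨d, hd⟩ := Nat.exists_eq_add_of_le h
      rw [hd]
      exact hag k d i hi
    · obtain ⟨d, rfl⟩ := Nat.exists_eq_add_of_le h
      exact (hag (i + 1) d i (hb.le_apply (x := i + 1))).symm
  refine ⟨fun i => (P (i + 1)).1.1 i, fun i => (P (i + 1)).2.2 i, fun hy => ?_⟩
  obtain ⟨k, hk⟩ := mem_iUnion.1 hy
  have : (fun i => (P (i + 1)).1.1 i) ∈ initSeg (P (k + 1)).1.1 (P (k + 1)).1.2 ∩ E k :=
    ⟨fun m hm => hlim (k + 1) m hm, hk⟩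
  rw [hP, hn3 k (P k)] at this
  exact this

theorem exists_dominating_functions :
    ∃ D : Set HilbertCube → ℕ → ℕ, ∀ f : ℕ → ℕ, ∃ X ∈ sigmaC0, ∀ Y, IsMeagre Y → X ⊆ Y →
      ∀ᶠ n in Filter.atTop, f n ≤ D Y n := by
  have h : ∀ Y : Set HilbertCube, ∃ ψ : ℕ → ℕ, IsMeagre Y → ∀ f : ℕ → ℕ, Monotone f →
      (∃ᶠ j in Filter.atTop, ψ j ≤ f j) → ∃ y : ℕ → ℕ, (∀ n, y n ≤ f n) ∧ baireToCube y ∉ Y := by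
    intro Y
    by_cases hY : IsMeagre Y
    · obtain ⟨E, hm, hE, hsub⟩ := exists_nat_cover hY
      choose ψ hψ using fun j => exists_uniform_bound (E j) (hE j).1 (hE j).2 j
      refine ⟨ψ, fun _ f hf hfr => ?_⟩
      obtain ⟨y, hyf, hy⟩ := exists_le_notMem E hm ψ f hf hψ hfr
      exact ⟨y, hyf, fun h => hy (hsub h)⟩
    · exact ⟨0, fun h => absurd h hY⟩
  choose D hD using h
  refine ⟨D, fun f => ?_⟩
  let f' : ℕ → ℕ := partialSups f
  have hne : ∀ a : ℕ, Set.Iic a ≠ Set.univ := fun a h =>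
    absurd (h ▸ mem_univ (a + 1) : a + 1 ∈ Set.Iic a) (by simp)
  obtain ⟨M, hM, hsub⟩ := exists_minimal_of_baire (fun n => Set.Iic (f' n))
    (Filter.Eventually.of_forall fun n => hne _) bddAbove_Iic
  refine ⟨M, mem_sigmaC0_of_mem hM le_rfl, fun Y hY hMY => ?_⟩
  by_contra hcon
  rw [Filter.not_eventually] at hcon
  obtain ⟨y, hyf, hy⟩ := hD Y hY f' (partialSups f).monotone
    (hcon.mono fun n hn => (not_le.1 hn).le.trans (le_partialSups f n))
  exact hy (hMY (hsub ⟨y, hyf, rfl⟩))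

/-- The iterates of a function, forced to increase strictly. -/
def growth (D : ℕ → ℕ) : ℕ → ℕ
  | 0 => 0
  | n + 1 => max (D (growth D n)) (growth D n + 1)

theorem growth_strictMono (D : ℕ → ℕ) : StrictMono (growth D) :=
  strictMono_nat_of_lt_succ fun _ => Nat.lt_of_succ_le (le_max_right _ _)

section Moves

variable {X : Type*} (U : ℕ → Set X) (dec : ℕ → ℕ → ℕ) (D w D' : ℕ → ℕ)

open Classical in
/-- The replacement of the index `i` proposed by the code `w n`, if it is an admissible one. -/
noncomputable def move (n i : ℕ) : ℕ :=
  if dec (w n) i ≤ growth D (n + 1) ∧ U (dec (w n) i) ⊆ U i then dec (w n) i else i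

/-- The result of `m` consecutive moves, the first of them being the `n`th one. -/
noncomputable def moves (n : ℕ) : ℕ → ℕ → ℕ
  | 0, i => i
  | m + 1, i => move U dec D w (n + m) (moves n m i)

theorem move_subset (n i : ℕ) : U (move U dec D w n i) ⊆ U i := by
  unfold move
  split_ifs with h
  · exact h.2
  · exact le_rfl

theorem move_le (n i : ℕ) (hi : i ≤ growth D n) : move U dec D w n i ≤ growth D (n + 1) := by
  unfold move
  split_ifs with h
  · exact h.1
  · exact hi.trans ((growth_strictMono D).monotone (Nat.le_succ n))

theorem moves_antitone (n i : ℕ) : Antitone fun m => U (moves U dec D w n m i) :=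
  antitone_nat_of_succ_le fun _ => move_subset U dec D w _ _

theorem moves_le (n m i : ℕ) (hi : i ≤ growth D n) : moves U dec D w n m i ≤ growth D (n + m) := by
  induction m with
  | zero => exact hi
  | succ m ih => exact move_le U dec D w _ _ ih

/-- The union of the basic sets obtained by all moves of the `k`th block. -/
noncomputable def stageSet (k : ℕ) : Set X :=
  ⋃ i ∈ Set.Iic (growth D (growth D' k)),
    U (moves U dec D w (growth D' k) (growth D' (k + 1) - growth D' k) i)

/-- The set of points which belong to infinitely many stage sets. -/
noncomputable def limsupSet : Set X := ⋂ p, ⋃ k ∈ Set.Ici p, stageSet U dec D w D' k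

theorem isMeagre_compl_limsupSet [TopologicalSpace X] (hU : ∀ i, IsOpen (U i) ∧ (U i).Nonempty)
    (hb : ∀ O : Set X, IsOpen O → O.Nonempty → ∃ i, U i ⊆ O) :
    IsMeagre (limsupSet U dec D w D')ᶜ := by
  rw [IsMeagre, compl_compl]
  refine countable_iInter_mem.2 fun p => residual_of_dense_open ?_ ?_
  · exact isOpen_biUnion fun k _ => isOpen_biUnion fun i _ => (hU _).1
  · rw [dense_iff_inter_open]
    intro O hO hne
    obtain ⟨i, hi⟩ := hb O hO hne
    set k := max p i
    have hk : i ≤ growth D (growth D' k) := (le_max_right p i).trans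
      (((growth_strictMono D').le_apply).trans (growth_strictMono D).le_apply)
    obtain ⟨x, hx⟩ := (hU (moves U dec D w (growth D' k) (growth D' (k + 1) - growth D' k) i)).2
    refine ⟨x, hi (moves_antitone U dec D w _ _ (Nat.zero_le _) hx), ?_⟩
    exact mem_biUnion (mem_Ici.2 (le_max_left p i)) (mem_biUnion (mem_Iic.2 hk) hx)

variable {U dec D w D'}

theorem disjoint_limsupSet {N : ℕ → Set X} (hN : Monotone N) {t : ℕ → ℕ → ℕ} {m₀ : ℕ}
    {S : Set ℕ} (hS : ∀ n ∈ S, m₀ ≤ n ∧ ∀ i ≤ growth D n, move U dec D w n i = t n i)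
    (ht : ∀ n ≥ m₀, ∀ i ≤ growth D n, Disjoint (U (t n i)) (N n)) {next : ℕ → ℕ}
    (hnext : ∀ n, next n ∈ S ∧ n ≤ next n) (hD' : ∀ᶠ n in Filter.atTop, next n + 1 ≤ D' n) :
    (⋃ n, N n) ⊆ (limsupSet U dec D w D')ᶜ := by
  intro x hx hxl
  obtain ⟨n, hn⟩ := mem_iUnion.1 hx
  obtain ⟨k₀, hk₀⟩ := Filter.eventually_atTop.1 hD'
  obtain ⟨k, hk, hxk⟩ := mem_iUnion₂.1 (mem_iInter.1 hxl (max n k₀))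
  obtain ⟨i, hi, hxi⟩ := mem_iUnion₂.1 hxk
  have hJ : max n k₀ ≤ growth D' k := (mem_Ici.1 hk).trans (growth_strictMono D').le_apply
  have hlt : next (growth D' k) + 1 ≤ growth D' (k + 1) :=
    (hk₀ _ ((le_max_right _ _).trans hJ)).trans (le_max_left _ _)
  obtain ⟨hmem, hge⟩ := hnext (growth D' k)
  obtain ⟨d, hd⟩ := Nat.exists_eq_add_of_le hge
  rw [hd] at hmem hlt
  have h1 : x ∈ U (moves U dec D w (growth D' k) (d + 1) i) :=
    moves_antitone U dec D w _ _ (by omega) hxi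
  have h2 := moves_le U dec D w (growth D' k) d i hi
  rw [moves, (hS _ hmem).2 _ h2] at h1
  refine disjoint_left.1 (ht _ (hS _ hmem).1 _ h2) h1 (hN ?_ hn)
  exact (le_max_left _ _).trans (hJ.trans (Nat.le_add_right _ _))

end Moves

theorem exists_universal_decoding :
    ∃ dec : ℕ → ℕ → ℕ, ∀ (t : ℕ → ℕ) (b : ℕ), ∃ c, ∀ i ≤ b, dec c i = t i := by
  obtain ⟨f, hf⟩ := exists_surjective_nat (List ℕ)
  refine ⟨fun c i => (f c).getD i 0, fun t b => ?_⟩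
  obtain ⟨c, hc⟩ := hf ((List.range (b + 1)).map t)
  refine ⟨c, fun i hi => ?_⟩
  have : i < b + 1 := by omega
  simp [hc, this]

theorem exists_nat_pi_basis (X : Type*) [TopologicalSpace X] [SecondCountableTopology X]
    [Nonempty X] :
    ∃ U : ℕ → Set X, (∀ i, IsOpen (U i) ∧ (U i).Nonempty) ∧
      ∀ O : Set X, IsOpen O → O.Nonempty → ∃ i, U i ⊆ O := by
  obtain ⟨b, hbc, hbe, hb⟩ := TopologicalSpace.exists_countable_basis X
  have hbne : b.Nonempty := by
    obtain ⟨s, hs, -⟩ := hb.exists_subset_of_mem_open (mem_univ (Classical.arbitrary X)) isOpen_univ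
    exact ⟨s, hs⟩
  obtain ⟨U, hU⟩ := hbc.exists_eq_range hbne
  have hUb : ∀ i, U i ∈ b := fun i => hU ▸ mem_range_self i
  refine ⟨U, fun i => ⟨hb.isOpen (hUb i), ?_⟩, fun O hO ⟨x, hx⟩ => ?_⟩
  · rw [nonempty_iff_ne_empty]
    exact fun h => hbe (h ▸ hUb i)
  · obtain ⟨s, hs, -, hsO⟩ := hb.exists_subset_of_mem_open hx hO
    rw [hU] at hs
    obtain ⟨i, rfl⟩ := hs
    exact ⟨i, hsO⟩

/-- A cofinal family of meager sets obtained from dominating and infinitely often equal families of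
functions. -/
theorem exists_limsupSet_disjoint {X : Type*} [TopologicalSpace X] {U : ℕ → Set X}
    (hU : ∀ i, IsOpen (U i) ∧ (U i).Nonempty)
    (hb : ∀ O : Set X, IsOpen O → O.Nonempty → ∃ i, U i ⊆ O) {dec : ℕ → ℕ → ℕ}
    (hdec : ∀ (t : ℕ → ℕ) (b : ℕ), ∃ c, ∀ i ≤ b, dec c i = t i) {ι : Type*} {D w : ι → ℕ → ℕ}
    (hD : ∀ f : ℕ → ℕ, ∃ a, ∀ᶠ n in Filter.atTop, f n ≤ D a n)
    (hw : ∀ g : ℕ → ℕ, ∃ a, ∃ᶠ n in Filter.atTop, w a n = g n) {Y : Set X} (hY : IsMeagre Y) :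
    ∃ a b c, Y ⊆ (limsupSet U dec (D a) (w b) (D c))ᶜ := by
  obtain ⟨N, hNm, hN, hYN⟩ := exists_monotone_cover hY
  have hs : ∀ m i, ∃ t, U t ⊆ U i \ N m := fun m i => by
    refine hb _ ((hU i).1.sdiff (hN m).1) ?_
    by_contra hcon
    rw [not_nonempty_iff_eq_empty, sdiff_eq_empty] at hcon
    have := interior_maximal hcon (hU i).1
    rw [(hN m).2] at this
    exact (hU i).2.ne_empty (subset_empty_iff.1 this)
  choose t ht using hs
  obtain ⟨a, ha⟩ := hD fun m => (Finset.range (m + 1)).sup (t m)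
  obtain ⟨m₀, hm₀⟩ := Filter.eventually_atTop.1 ha
  choose g hg using fun n => hdec (t (growth (D a) n)) (growth (D a) n)
  obtain ⟨b, hbg⟩ := hw g
  have hmono := growth_strictMono (D a)
  let S : Set ℕ := {n | m₀ ≤ n ∧ w b n = g n}
  have hS : ∀ n, ∃ s, s ∈ S ∧ n ≤ s := fun n => by
    obtain ⟨s, hs1, hs2⟩ := Filter.frequently_atTop.1 hbg (max m₀ n)
    exact ⟨s, ⟨(le_max_left _ _).trans hs1, hs2⟩, (le_max_right _ _).trans hs1⟩
  choose next hnext using hS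
  obtain ⟨c, hc⟩ := hD fun n => next n + 1
  refine ⟨a, b, c, hYN.trans (disjoint_limsupSet hNm (m₀ := m₀) (S := S)
    (t := fun n i => t (growth (D a) n) i) (fun n hn => ⟨hn.1, fun i hi => ?_⟩)
    (fun n _ i _ => ?_) hnext hc)⟩
  · have h1 : dec (w b n) i = t (growth (D a) n) i := by rw [hn.2, hg n i hi]
    have h2 : t (growth (D a) n) i ≤ growth (D a) (n + 1) :=
      ((Finset.le_sup (Finset.mem_range.2 (Nat.lt_succ_of_le hi))).trans
        (hm₀ _ (hn.1.trans hmono.le_apply))).trans (le_max_left _ _)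
    rw [move, h1, if_pos ⟨h2, (ht _ _).trans sdiff_subset⟩]
  · exact disjoint_left.2 fun x hx hxN => (ht _ _ hx).2 (hNm hmono.le_apply hxN)

theorem IsCantorSet.isMeagre {C : Set HilbertCube} (hC : IsCantorSet C) : IsMeagre C := by
  obtain ⟨K⟩ := hC
  have hcomp : IsCompact C := by
    have := K.symm.compactSpace
    exact isCompact_iff_compactSpace.2 this
  have hcl := hcomp.isClosed
  have hT : IsTotallyDisconnected C := by
    have : TotallyDisconnectedSpace C :=
      ⟨isTotallyDisconnected_of_image K.continuous.continuousOn K.injective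
        (isTotallyDisconnected_of_totallyDisconnectedSpace _)⟩
    exact totallyDisconnectedSpace_subtype_iff.1 this
  have hi : interior C = ∅ := by
    by_contra hne
    obtain ⟨x, hx⟩ := nonempty_iff_ne_empty.2 hne
    obtain ⟨I, u, hu, hsub⟩ := isOpen_pi_iff.1 isOpen_interior x hx
    obtain ⟨n, hn⟩ := I.exists_notMem
    have hline : ∀ s : UI, Function.update x n s ∈ C := fun s => by
      refine interior_subset (hsub fun i hi => ?_)
      have hne : i ≠ n := fun h => hn (h ▸ Finset.mem_coe.1 hi)
      rw [Function.update_of_ne hne]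
      exact (hu i hi).2
    have hcon : IsPreconnected (range fun s : UI => Function.update x n s) :=
      isPreconnected_range (continuous_const.update n continuous_id)
    have h01 := hT _ (by rintro _ ⟨s, rfl⟩; exact hline s) hcon (mem_range_self 0)
      (mem_range_self 1)
    have := congrFun h01 n
    simp at this
  exact IsNowhereDense.isMeagre (by rw [IsNowhereDense, hcl.closure_eq, hi])

theorem sigmaC0_subset : sigmaC0 ⊆ MeagerIdeal HilbertCube := by
  rintro A ⟨S, hS, hA⟩
  exact (isMeagre_iUnion fun n => (hS n).1.isMeagre).mono hA

theorem exists_cofinal_meager {A : Set (Set HilbertCube)} (hA : A ⊆ MeagerIdeal HilbertCube)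
    (hc : ∀ B ∈ sigmaC0, ∃ C ∈ A, B ⊆ C) :
    ∃ A' ⊆ MeagerIdeal HilbertCube, (∀ B ∈ MeagerIdeal HilbertCube, ∃ C ∈ A', B ⊆ C) ∧
      #A' ≤ #A := by
  obtain ⟨D₀, hD₀⟩ := exists_dominating_functions
  obtain ⟨w₀, hw₀⟩ := exists_infinitely_equal_functions
  have hD : ∀ f : ℕ → ℕ, ∃ a : A, ∀ᶠ n in Filter.atTop, f n ≤ D₀ a n := fun f => by
    obtain ⟨X, hX, h⟩ := hD₀ f
    obtain ⟨C, hC, hXC⟩ := hc X hX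
    exact ⟨⟨C, hC⟩, h C (hA hC) hXC⟩
  have hw : ∀ g : ℕ → ℕ, ∃ a : A, ∃ᶠ n in Filter.atTop, w₀ a n = g n := fun g => by
    obtain ⟨X, hX, h⟩ := hw₀ g
    obtain ⟨C, hC, hXC⟩ := hc X hX
    exact ⟨⟨C, hC⟩, h C (hA hC) hXC⟩
  have hinf : Infinite A := by
    by_contra hfin
    rw [not_infinite_iff_finite] at hfin
    have := Fintype.ofFinite A
    obtain ⟨a, ha⟩ := hD fun n => ∑ a : A, D₀ a n + 1
    obtain ⟨n, hn⟩ := ha.exists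
    have h1 := Finset.single_le_sum (f := fun a : A => D₀ a n) (fun _ _ => Nat.zero_le _)
      (Finset.mem_univ a)
    exact absurd (hn.trans h1) (Nat.not_succ_le_self _)
  obtain ⟨U, hU, hb⟩ := exists_nat_pi_basis HilbertCube
  obtain ⟨dec, hdec⟩ := exists_universal_decoding
  refine ⟨range fun p : A × A × A => (limsupSet U dec (D₀ p.1) (w₀ p.2.1) (D₀ p.2.2))ᶜ, ?_, ?_, ?_⟩
  · rintro _ ⟨p, rfl⟩
    exact isMeagre_compl_limsupSet U dec _ _ _ hU hb
  · intro B hB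
    obtain ⟨a, b, c, h⟩ := exists_limsupSet_disjoint hU hb hdec (D := fun a : A => D₀ a)
      (w := fun a : A => w₀ a) hD hw hB
    exact ⟨_, ⟨(a, b, c), rfl⟩, h⟩
  · refine mk_range_le.trans ?_
    have h := aleph0_le_mk A
    rw [mk_prod, mk_prod]
    simp only [lift_id, mul_eq_self h, le_refl]

/-- `cof(σC₀, M) = cof(M)`. -/
theorem cof_sigmaC0_meager_eq_cof_meager :
    cofIdeal2 sigmaC0 (MeagerIdeal HilbertCube) = cofIdeal (MeagerIdeal HilbertCube) := by
  unfold cofIdeal cofIdeal2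
  apply le_antisymm
  · apply le_csInf
    · exact ⟨_, MeagerIdeal HilbertCube, le_rfl, fun B hB => ⟨B, hB, le_rfl⟩, rfl⟩
    · rintro c ⟨A, hA, hc, rfl⟩
      apply csInf_le'
      exact ⟨A, hA, fun B hB => hc B (sigmaC0_subset hB), rfl⟩
  · apply le_csInf
    · exact ⟨_, MeagerIdeal HilbertCube, le_rfl, fun B hB => ⟨B, sigmaC0_subset hB, le_rfl⟩, rfl⟩
    · rintro c ⟨A, hA, hc, rfl⟩
      obtain ⟨A', hA', hc', hcard⟩ := exists_cofinal_meager hA hc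
      refine le_trans ?_ hcard
      apply csInf_le'
      exact ⟨A', hA', hc', rfl⟩
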